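/- arXiv:0903.2904 — 2 statements merged into one kernel-verified Lean document; each statement's English description precedes it below -/
import Mathlib

section
/- The potential satisfiability problem for PTLTL^FO with linear arithmetic is decidable: there is a computable function which, given (under the natural encodings) a po-history h, an index i with 1 ≤ i ≤ |h|, and a closed formula ψ of PTLTL^FO with linear arithmetic, returns true if (h,i) ⊢ ψ and false otherwise. -/
/-- A linear term `k₁x₁ + ⋯ + kₙxₙ + c` over ℤ, given by the list of pairs
(coefficient, variable) and the constant. -/
structure LTm : Type where
  coeffs : List (ℤ × ℕ)
  const : ℤ
  deriving DecidableEq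

/-- Evaluation of a linear term under an environment. -/
def LTm.eval (ρ : ℕ → ℤ) (t : LTm) : ℤ :=
  (t.coeffs.map fun q => q.1 * ρ q.2).sum + t.const

/-- Variables of a linear term. -/
def LTm.vars (t : LTm) : List ℕ := t.coeffs.map Prod.snd

/-- Formulas of PTLTL^FO with linear arithmetic: uninterpreted predicate atoms and
the interpreted relations `=`, `≤`, `≥` over linear terms, conjunction, negation,
X⁻¹, S, and the guarded universal quantifier. -/
inductive LFm : Type where
  | atom : ℕ → List LTm → LFm
  | eq : LTm → LTm → LFm
  | le : LTm → LTm → LFm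
  | ge : LTm → LTm → LFm
  | and : LFm → LFm → LFm
  | not : LFm → LFm
  | prev : LFm → LFm
  | since : LFm → LFm → LFm
  | all : List ℕ → ℕ → LFm → LFm

/-- Free variables of a formula. -/
def LFm.fv : LFm → List ℕ
  | .atom _ ts => ts.flatMap LTm.vars
  | .eq s t => s.vars ++ t.vars
  | .le s t => s.vars ++ t.vars
  | .ge s t => s.vars ++ t.vars
  | .and a b => a.fv ++ b.fv
  | .not a => a.fv
  | .prev a => a.fv
  | .since a b => a.fv ++ b.fv
  | .all xs _ a => a.fv.filter (fun v => v ∉ xs)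

/-- A formula is closed if it has no free variables. -/
def LFm.Closed (φ : LFm) : Prop := φ.fv = []

/-- A session: a finite set of events `p(c₁,…,cₙ)` with integer constants. -/
abbrev ZSession := Finset (ℕ × List ℤ)

/-- Update an environment on the list of variables `xs` with the list of values `cs`. -/
def updEnv (ρ : ℕ → ℤ) (xs : List ℕ) (cs : List ℤ) : ℕ → ℤ :=
  fun v => ((xs.zip cs).lookup v).getD (ρ v)

/-- The forcing relation `(h,i) ⊨ φ` for PTLTL^FO with linear arithmetic. -/
def LSat (h : List ZSession) : ℕ → (ℕ → ℤ) → LFm → Prop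
  | i, ρ, .atom p ts => (p, ts.map (LTm.eval ρ)) ∈ h.getD (i - 1) ∅
  | i, ρ, .eq s t => s.eval ρ = t.eval ρ
  | i, ρ, .le s t => s.eval ρ ≤ t.eval ρ
  | i, ρ, .ge s t => s.eval ρ ≥ t.eval ρ
  | i, ρ, .and a b => LSat h i ρ a ∧ LSat h i ρ b
  | i, ρ, .not a => ¬ LSat h i ρ a
  | i, ρ, .prev a => 1 < i ∧ LSat h (i - 1) ρ a
  | i, ρ, .since a b =>
      ∃ j, 1 ≤ j ∧ j ≤ i ∧ LSat h j ρ b ∧ ∀ k, j < k → k ≤ i → LSat h k ρ a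
  | i, ρ, .all xs p a =>
      ∀ cs : List ℤ, cs.length = xs.length → (p, cs) ∈ h.getD (i - 1) ∅ →
        LSat h i (updEnv ρ xs cs) a

/-- A partially observable session: a finite set of atoms whose arguments are
variables (`Sum.inl`) or integer constants (`Sum.inr`). -/
abbrev ZPoSession := Finset (ℕ × List (ℕ ⊕ ℤ))

/-- A partially observable history. -/
abbrev ZPoHistory := List ZPoSession

/-- The variable `x` occurs in the po-history `h` (i.e. `x ∈ V(h)`). -/
def VarIn (x : ℕ) (h : ZPoHistory) : Prop :=
  ∃ s ∈ h, ∃ e ∈ s, Sum.inl x ∈ e.2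

/-- Applying a substitution `σ` to a po-history yields an ordinary history. -/
def applySub (σ : ℕ → ℤ) (h : ZPoHistory) : List ZSession :=
  h.map fun s => s.image fun e => (e.1, e.2.map (Sum.elim σ id))

/-- A natural-number encoding of linear terms. -/
def LTm.enc (t : LTm) : ℕ :=
  Nat.pair (Encodable.encode t.coeffs) (Encodable.encode t.const)

/-- A natural-number encoding of formulas. -/
def LFm.enc : LFm → ℕ
  | .atom p ts => Nat.pair 0 (Nat.pair p (Encodable.encode (ts.map LTm.enc)))
  | .eq s t => Nat.pair 1 (Nat.pair s.enc t.enc)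
  | .le s t => Nat.pair 2 (Nat.pair s.enc t.enc)
  | .ge s t => Nat.pair 3 (Nat.pair s.enc t.enc)
  | .and a b => Nat.pair 4 (Nat.pair a.enc b.enc)
  | .not a => Nat.pair 5 a.enc
  | .prev a => Nat.pair 6 a.enc
  | .since a b => Nat.pair 7 (Nat.pair a.enc b.enc)
  | .all xs p a => Nat.pair 8 (Nat.pair (Encodable.encode xs) (Nat.pair p a.enc))

/-- `h` potentially satisfies the closed formula `ψ` at `i`, written `(h,i) ⊢ ψ`. -/
def LPotSat (h : ZPoHistory) (i : ℕ) (ψ : LFm) : Prop :=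
  ∃ σ : ℕ → ℤ, ∀ ρ : ℕ → ℤ, LSat (applySub σ h) i ρ ψ

/-- `h` adheres to the closed formula `ψ` at `i`, written `(h,i) ⊩ ψ`. -/
def LAdheres (h : ZPoHistory) (i : ℕ) (ψ : LFm) : Prop :=
  ∀ σ : ℕ → ℤ, ∀ ρ : ℕ → ℤ, LSat (applySub σ h) i ρ ψ


/-! ### Part A: small solutions for sign conditions of linear forms -/

namespace PTL

/-- The linear form `∑ i < n, a i * x i + c`. -/
def lin (n : ℕ) (a : ℕ → ℤ) (c : ℤ) (x : ℕ → ℤ) : ℤ :=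
  ∑ i ∈ Finset.range n, a i * x i + c

/-- `x` and `y` agree on signs of all forms with coefficients bounded by `K`, and modulo `M`. -/
def Rel (n K M : ℕ) (x y : ℕ → ℤ) : Prop :=
  (∀ (a : ℕ → ℤ) (c : ℤ), (∀ i, |a i| ≤ K) → |c| ≤ K → (0 < lin n a c x ↔ 0 < lin n a c y)) ∧
  ∀ i < n, (M : ℤ) ∣ x i - y i

theorem lin_sub (n : ℕ) (a b : ℕ → ℤ) (c d : ℤ) (x : ℕ → ℤ) :
    lin n (fun i => a i - b i) (c - d) x = lin n a c x - lin n b d x := by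
  simp only [lin, sub_mul, Finset.sum_sub_distrib]; ring

theorem lin_add (n : ℕ) (a b : ℕ → ℤ) (c d : ℤ) (x : ℕ → ℤ) :
    lin n (fun i => a i + b i) (c + d) x = lin n a c x + lin n b d x := by
  simp only [lin, add_mul, Finset.sum_add_distrib]; ring

theorem lin_smul (n : ℕ) (k : ℤ) (a : ℕ → ℤ) (c : ℤ) (x : ℕ → ℤ) :
    lin n (fun i => k * a i) (k * c) x = k * lin n a c x := by
  simp only [lin, mul_assoc, mul_add, Finset.mul_sum]

theorem lin_neg (n : ℕ) (a : ℕ → ℤ) (c : ℤ) (x : ℕ → ℤ) :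
    lin n (fun i => - a i) c (fun i => - x i) = lin n a c x := by
  simp [lin]

theorem lin_bound (n : ℕ) (a : ℕ → ℤ) (c : ℤ) (x : ℕ → ℤ) (R B : ℤ) (ha : ∀ i, |a i| ≤ R)
    (hc : |c| ≤ R) (hx : ∀ i < n, |x i| ≤ B) : |lin n a c x| ≤ R * n * B + R := by
  have h1 : |∑ i ∈ Finset.range n, a i * x i| ≤ ∑ i ∈ Finset.range n, R * B := by
    refine (Finset.abs_sum_le_sum_abs _ _).trans (Finset.sum_le_sum fun i hi => ?_)
    rw [abs_mul]
    exact mul_le_mul (ha i) (hx i (Finset.mem_range.1 hi)) (abs_nonneg _)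
      ((abs_nonneg _).trans (ha i))
  have h2 : ∑ i ∈ Finset.range n, R * B = R * n * B := by simp; ring
  unfold lin
  exact (abs_add_le _ _).trans (by linarith)

theorem lin_dvd (n : ℕ) (a : ℕ → ℤ) (c : ℤ) (x y : ℕ → ℤ) (M : ℤ)
    (h : ∀ i < n, M ∣ x i - y i) : M ∣ lin n a c x - lin n a c y := by
  have : lin n a c x - lin n a c y = ∑ i ∈ Finset.range n, a i * (x i - y i) := by
    simp only [lin, mul_sub, Finset.sum_sub_distrib]; ring
  rw [this]
  exact Finset.dvd_sum fun i hi => Dvd.dvd.mul_left (h i (Finset.mem_range.1 hi)) _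

theorem step_nonneg (n K M : ℕ) (hM : 0 < M) (x y : ℕ → ℤ) (B : ℕ)
    (hrel : Rel n (2 * (K.factorial * K) + K.factorial * M) (K.factorial * M) x y)
    (hB : ∀ i < n, |y i| ≤ B) (s : ℤ) (hs : 0 ≤ s) :
    ∃ t : ℤ, |t| ≤ ((K.factorial * K) * n * B + K.factorial * K + K.factorial * M : ℕ) ∧
      (M : ℤ) ∣ s - t ∧
      ∀ (v : ℕ → ℤ) (d : ℤ), (∀ i, |v i| ≤ (K.factorial * K : ℕ)) → |d| ≤ (K.factorial * K : ℕ) →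
        (lin n v d x < K.factorial * s ↔ lin n v d y < K.factorial * t) ∧
        (K.factorial * s < lin n v d x ↔ K.factorial * t < lin n v d y) := by
  have hDpos : 0 < K.factorial := K.factorial_pos
  generalize K.factorial = D at *
  obtain ⟨hpos, hdvd⟩ := hrel
  set R : ℕ := D * K with hR
  set E : ℕ := D * M with hE
  have hEpos : 0 < E := Nat.mul_pos hDpos hM
  let P : ℤ → Prop := fun z => z ≤ D * s ∧ ∃ (a : ℕ → ℤ) (c : ℤ), (∀ i, |a i| ≤ R) ∧ |c| ≤ R ∧
    lin n a c x = z
  have hP0 : ∃ z, P z := ⟨0, by positivity, fun _ => 0, 0, by simp, by simp, by simp [lin]⟩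
  obtain ⟨z, ⟨hz, a, c, ha, hc, hac⟩, hmax⟩ :=
    Int.exists_greatest_of_bdd ⟨D * s, fun z hz => hz.1⟩ hP0
  obtain ⟨δ0, hδ0⟩ : ∃ δ0, δ0 = D * s - z := ⟨_, rfl⟩
  have hδ0n : 0 ≤ δ0 := by linarith
  obtain ⟨δ, hδn, hδE, hδle, hδz, hδd⟩ : ∃ δ : ℤ, 0 ≤ δ ∧ δ ≤ E ∧ δ ≤ δ0 ∧ (δ = 0 → δ0 = 0) ∧
      (E : ℤ) ∣ δ0 - δ := by
    by_cases h0 : δ0 = 0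
    · exact ⟨0, le_rfl, by positivity, hδ0n, fun _ => h0, by simp [h0]⟩
    · have hE' : (0 : ℤ) < E := by exact_mod_cast hEpos
      have h1 := Int.emod_nonneg (δ0 - 1) hE'.ne'
      have h2 := Int.emod_lt_of_pos (δ0 - 1) hE'
      have h3 := Int.emod_add_mul_ediv (δ0 - 1) E
      have h4 : 0 ≤ (δ0 - 1) / E := Int.ediv_nonneg (by omega) hE'.le
      have h5 : 0 ≤ (E : ℤ) * ((δ0 - 1) / E) := by positivity
      refine ⟨(δ0 - 1) % E + 1, by omega, by omega, by omega, by omega, (δ0 - 1) / E, by linarith⟩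
  have hq : (E : ℤ) ∣ (lin n a c y + δ) - D * s := by
    have h1 := lin_dvd n a c x y E hdvd
    have h2 : (lin n a c y + δ) - D * s = -(lin n a c x - lin n a c y) - (δ0 - δ) := by
      rw [hδ0, hac]; ring
    rw [h2]
    exact dvd_sub (h1.neg_right) hδd
  obtain ⟨q, hq⟩ := hq
  have hDt : (D : ℤ) * (s + M * q) = lin n a c y + δ := by
    rw [hE] at hq; push_cast at hq; linarith
  have key : ∀ (v : ℕ → ℤ) (d e : ℤ), (∀ i, |v i| ≤ R) → |d| ≤ R → |e| ≤ E →
      (lin n a c x + e < lin n v d x ↔ lin n a c y + e < lin n v d y) := by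
    intro v d e hv hd he
    have := hpos (fun i => v i - a i) (d - c - e)
      (fun i => by have := ha i; have := hv i; push_cast; rw [abs_le] at *; constructor <;> linarith)
      (by push_cast; rw [abs_le] at *; constructor <;> linarith)
    have e1 : ∀ w, lin n (fun i => v i - a i) (d - c - e) w = lin n v d w - lin n a c w - e := by
      intro w
      rw [← lin_sub]; simp only [lin]; ring
    rw [e1, e1] at this
    constructor
    · intro h; have := this.1 (by linarith); linarith
    · intro h; have := this.2 (by linarith); linarith
  refine ⟨s + M * q, ?_, ⟨-q, by ring⟩, ?_⟩
  · have h1 := lin_bound n a c y R B ha hc hB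
    have h2 : |lin n a c y + δ| ≤ R * n * B + R + E := by
      refine (abs_add_le _ _).trans ?_
      rw [abs_of_nonneg hδn]; linarith
    rw [← hDt, abs_mul] at h2
    have h3 : (1 : ℤ) ≤ |(D : ℤ)| := by rw [abs_of_nonneg (by positivity)]; exact_mod_cast hDpos
    push_cast
    have h4 : (R : ℤ) = D * K := by rw [hR]; push_cast; rfl
    have h5 : (E : ℤ) = D * M := by rw [hE]; push_cast; rfl
    nlinarith [abs_nonneg (s + M * q)]
  · intro v d hv hd
    rw [hDt]
    have hDs : (D : ℤ) * s = lin n a c x + δ0 := by rw [hδ0, hac]; ring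
    have f1 : lin n v d x ≤ D * s → lin n v d y ≤ lin n a c y := by
      intro h
      have h1 := hmax _ ⟨h, v, d, hv, hd, rfl⟩
      by_contra h2
      have := (key v d 0 hv hd (by simp)).2 (by linarith)
      linarith
    have f2 : D * s < lin n v d x → lin n a c y + δ < lin n v d y := by
      intro h
      exact (key v d δ hv hd (by rw [abs_of_nonneg hδn]; exact hδE)).1 (by linarith)
    have f3 : lin n v d x < D * s → lin n v d y < lin n a c y + δ := by
      intro h
      have h1 := f1 h.le
      rcases hδn.lt_or_eq with h2 | h2
      · linarith
      · have h3 := hδz h2.symm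
        -- here the two sides coincide at `z`, use the reversed comparison
        rcases h1.lt_or_eq with h4 | h4
        · linarith
        · exfalso
          have := hpos (fun i => a i - v i) (c - d)
            (fun i => by
              have := ha i; have := hv i; push_cast; rw [abs_le] at *; constructor <;> linarith)
            (by push_cast; rw [abs_le] at *; constructor <;> linarith)
          rw [lin_sub, lin_sub] at this
          have := this.1 (by linarith)
          linarith
    have f4 : lin n v d x = D * s → lin n v d y = lin n a c y + δ := by
      intro h
      have h1 := f1 h.le
      have h0 : lin n v d x ≤ z := hmax _ ⟨h.le, v, d, hv, hd, rfl⟩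
      have hδ' : δ = 0 := by linarith
      by_contra h3
      have := hpos (fun i => a i - v i) (c - d)
        (fun i => by
          have := ha i; have := hv i; push_cast; rw [abs_le] at *; constructor <;> linarith)
        (by push_cast; rw [abs_le] at *; constructor <;> linarith)
      rw [lin_sub, lin_sub] at this
      have h5 : lin n v d y < lin n a c y := lt_of_le_of_ne h1 (by intro h6; apply h3; linarith)
      have := this.2 (by linarith)
      linarith
    constructor
    · refine ⟨f3, fun h => ?_⟩
      by_contra h1
      rcases (not_lt.1 h1).lt_or_eq with h2 | h2
      · have := f2 h2; linarith
      · have := f4 h2.symm; linarith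
    · refine ⟨f2, fun h => ?_⟩
      by_contra h1
      rcases (not_lt.1 h1).lt_or_eq with h2 | h2
      · have := f3 h2; linarith
      · have := f4 h2; linarith

theorem step_any (n K M : ℕ) (hM : 0 < M) (x y : ℕ → ℤ) (B : ℕ)
    (hrel : Rel n (2 * (K.factorial * K) + K.factorial * M) (K.factorial * M) x y)
    (hB : ∀ i < n, |y i| ≤ B) (s : ℤ) :
    ∃ t : ℤ, |t| ≤ ((K.factorial * K) * n * B + K.factorial * K + K.factorial * M : ℕ) ∧
      (M : ℤ) ∣ s - t ∧
      ∀ (v : ℕ → ℤ) (d : ℤ), (∀ i, |v i| ≤ (K.factorial * K : ℕ)) → |d| ≤ (K.factorial * K : ℕ) →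
        (lin n v d x < K.factorial * s ↔ lin n v d y < K.factorial * t) ∧
        (K.factorial * s < lin n v d x ↔ K.factorial * t < lin n v d y) := by
  rcases le_total 0 s with hs | hs
  · exact step_nonneg n K M hM x y B hrel hB s hs
  · have hrel' : Rel n (2 * (K.factorial * K) + K.factorial * M) (K.factorial * M)
        (fun i => - x i) (fun i => - y i) := by
      refine ⟨fun a c ha hc => ?_, fun i hi => ?_⟩
      · have := hrel.1 (fun i => - a i) c (fun i => by simpa using ha i) hc
        rw [← lin_neg n (fun i => - a i) c x, ← lin_neg n (fun i => - a i) c y] at this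
        simpa using this
      · rw [show (fun i => - x i) i - (fun i => - y i) i = -(x i - y i) by simp only []; ring]
        exact (hrel.2 i hi).neg_right
    obtain ⟨t, h1, h2, h3⟩ := step_nonneg n K M hM _ _ B hrel' (fun i hi => by simpa using hB i hi)
      (-s) (by linarith)
    refine ⟨-t, by simpa using h1, ?_, fun v d hv hd => ?_⟩
    · rw [show s - -t = -(-s - t) by ring]
      exact h2.neg_right
    · have := h3 v (-d) hv (by simpa using hd)
      have e : ∀ w : ℕ → ℤ, lin n v (-d) (fun i => - w i) = - lin n v d w := by
        intro w; simp [lin]; ring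
      rw [e, e] at this
      constructor
      · constructor
        · intro h; have := this.2.1 (by linarith); linarith
        · intro h; have := this.2.2 (by linarith); linarith
      · constructor
        · intro h; have := this.1.1 (by linarith); linarith
        · intro h; have := this.1.2 (by linarith); linarith

/-- The bound for small solutions. -/
def Bd : ℕ → ℕ → ℕ → ℕ
  | 0, _, _ => 0
  | n + 1, K, M =>
    Bd n (2 * (K.factorial * K) + K.factorial * M) (K.factorial * M) +
    ((K.factorial * K) * n * Bd n (2 * (K.factorial * K) + K.factorial * M) (K.factorial * M)
      + K.factorial * K + K.factorial * M)

theorem lin_congr (n : ℕ) (a : ℕ → ℤ) (c : ℤ) (x y : ℕ → ℤ) (h : ∀ i < n, x i = y i) :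
    lin n a c x = lin n a c y := by
  unfold lin
  rw [Finset.sum_congr rfl fun i hi => by rw [h i (Finset.mem_range.1 hi)]]

theorem exists_small (n : ℕ) : ∀ (K M : ℕ), 0 < M → ∀ x : ℕ → ℤ,
    ∃ y : ℕ → ℤ, Rel n K M x y ∧ ∀ i < n, |y i| ≤ Bd n K M := by
  induction n with
  | zero => intro K M _ x; exact ⟨x, ⟨fun _ _ _ _ => Iff.rfl, by simp⟩, by simp⟩
  | succ n ih =>
    intro K M hM x
    have hD := K.factorial_pos
    obtain ⟨y, hrel, hB⟩ := ih (2 * (K.factorial * K) + K.factorial * M) (K.factorial * M)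
      (by positivity) x
    obtain ⟨t, h1, h2, h3⟩ := step_any n K M hM x y _ hrel hB (x n)
    refine ⟨Function.update y n t, ⟨?_, ?_⟩, ?_⟩
    · intro a c ha hc
      have e1 : lin (n + 1) a c x = lin n a c x + a n * x n := by
        simp [lin, Finset.sum_range_succ]; ring
      have e2 : lin (n + 1) a c (Function.update y n t) = lin n a c y + a n * t := by
        have := lin_congr n a c (Function.update y n t) y
          (fun i hi => by simp [Function.update, hi.ne])
        rw [← this]
        simp [lin, Finset.sum_range_succ]; ring
      rw [e1, e2]
      -- scale the form
      have scale : ∀ b : ℤ, 0 < b → b ≤ K → ∃ k : ℤ, 0 < k ∧ b * k = K.factorial ∧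
          k ≤ K.factorial := by
        intro b hb hbK
        lift b to ℕ using hb.le
        have hb' : 0 < b := by exact_mod_cast hb
        have hbK' : b ≤ K := by exact_mod_cast hbK
        obtain ⟨k, hk⟩ := Nat.dvd_factorial hb' hbK'
        have hk0 : 0 < k := by
          rcases Nat.eq_zero_or_pos k with h | h
          · subst h; omega
          · exact h
        exact ⟨k, by exact_mod_cast hk0, by exact_mod_cast hk.symm,
          by rw [hk]; exact_mod_cast Nat.le_mul_of_pos_left k hb'⟩
      have bnd : ∀ k : ℤ, |k| ≤ K.factorial → ∀ w : ℤ, |w| ≤ K →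
          |k * w| ≤ (K.factorial * K : ℕ) := by
        intro k hk w hw
        rw [abs_mul]; push_cast
        exact mul_le_mul hk hw (abs_nonneg _) (by positivity)
      have han := abs_le.1 (ha n)
      rcases lt_trichotomy (a n) 0 with hb | hb | hb
      · obtain ⟨k, hk0, hk, hkD⟩ := scale (-(a n)) (by linarith) (by linarith)
        have := h3 (fun i => k * a i) (k * c)
          (fun i => bnd k (by rw [abs_of_pos hk0]; exact hkD) _ (ha i))
          (bnd k (by rw [abs_of_pos hk0]; exact hkD) _ hc)
        rw [lin_smul, lin_smul, ← hk] at this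
        have t2 := this.2
        have g : ∀ L w : ℤ, (-(a n) * k * w < k * L ↔ 0 < L + a n * w) := by
          intro L w
          rw [show -(a n) * k * w = k * (-(a n) * w) by ring, mul_lt_mul_iff_right₀ hk0]
          constructor <;> intro h <;> linarith
        rw [g, g] at t2
        exact t2
      · rw [hb]; simp only [zero_mul, add_zero]
        have hle : K ≤ 2 * (K.factorial * K) + K.factorial * M := by nlinarith
        have hle' : (K : ℤ) ≤ (2 * (K.factorial * K) + K.factorial * M : ℕ) := by exact_mod_cast hle
        exact hrel.1 a c (fun i => (ha i).trans hle') (hc.trans hle')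
      · obtain ⟨k, hk0, hk, hkD⟩ := scale (a n) hb (by linarith)
        have := h3 (fun i => -k * a i) (-k * c)
          (fun i => bnd (-k) (by rw [abs_neg, abs_of_pos hk0]; exact hkD) _ (ha i))
          (bnd (-k) (by rw [abs_neg, abs_of_pos hk0]; exact hkD) _ hc)
        rw [lin_smul, lin_smul, ← hk] at this
        have t2 := this.1
        have g : ∀ L w : ℤ, (-k * L < a n * k * w ↔ 0 < L + a n * w) := by
          intro L w
          rw [show -k * L = k * (-L) by ring, show a n * k * w = k * (a n * w) by ring,
            mul_lt_mul_iff_right₀ hk0]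
          constructor <;> intro h <;> linarith
        rw [g, g] at t2
        exact t2
    · intro i hi
      rcases Nat.lt_succ_iff_lt_or_eq.1 hi with h | h
      · have h4 := hrel.2 i h
        simp only [Function.update, h.ne, dite_false]
        refine dvd_trans ?_ h4
        exact ⟨K.factorial, by push_cast; ring⟩
      · subst h; simpa using h2
    · intro i hi
      have hmono : ∀ p q : ℕ, ((p : ℤ) ≤ (p + q : ℕ)) ∧ ((q : ℤ) ≤ (p + q : ℕ)) :=
        fun p q => by constructor <;> push_cast <;> linarith [Int.natCast_nonneg p, Int.natCast_nonneg q]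
      rcases Nat.lt_succ_iff_lt_or_eq.1 hi with h | h
      · simp only [Function.update, h.ne, dite_false]
        exact (hB i h).trans (hmono _ _).1
      · subst h
        simp only [Function.update_self]
        exact h1.trans (hmono _ _).2

end PTL

/-! ### Part B: satisfaction only depends on signs of bounded linear forms -/

namespace PTL

/-- `f` is a linear form in the first `n` variables with all coefficients bounded by `A`. -/
def IsF (n A : ℕ) (f : (ℕ → ℤ) → ℤ) : Prop :=
  ∃ (a : ℕ → ℤ) (c : ℤ), (∀ i, |a i| ≤ A) ∧ |c| ≤ A ∧ ∀ σ, f σ = lin n a c σ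

theorem IsF.mono {n A B : ℕ} {f} (h : IsF n A f) (hAB : A ≤ B) : IsF n B f := by
  obtain ⟨a, c, ha, hc, h⟩ := h
  have : (A : ℤ) ≤ B := by exact_mod_cast hAB
  exact ⟨a, c, fun i => (ha i).trans this, hc.trans this, h⟩

theorem IsF.add {n A B : ℕ} {f g} (hf : IsF n A f) (hg : IsF n B g) :
    IsF n (A + B) (fun σ => f σ + g σ) := by
  obtain ⟨a, c, ha, hc, h⟩ := hf
  obtain ⟨b, d, hb, hd, h'⟩ := hg
  refine ⟨fun i => a i + b i, c + d, fun i => ?_, ?_, fun σ => by simp only [lin_add, h, h']⟩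
  · have := abs_add_le (a i) (b i); have := ha i; have := hb i; push_cast; linarith
  · have := abs_add_le c d; push_cast; linarith

theorem IsF.smul {n A : ℕ} {f} (hf : IsF n A f) (k : ℤ) :
    IsF n (k.natAbs * A) (fun σ => k * f σ) := by
  obtain ⟨a, c, ha, hc, h⟩ := hf
  refine ⟨fun i => k * a i, k * c, fun i => ?_, ?_, fun σ => by simp only [lin_smul, h]⟩
  · rw [abs_mul]; push_cast; exact mul_le_mul_of_nonneg_left (ha i) (abs_nonneg _)
  · rw [abs_mul]; push_cast; exact mul_le_mul_of_nonneg_left hc (abs_nonneg _)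

theorem IsF.const (n : ℕ) (c : ℤ) : IsF n c.natAbs (fun _ => c) :=
  ⟨fun _ => 0, c, by simp, by simp, by simp [lin]⟩

theorem IsF.var {n v : ℕ} (hv : v < n) : IsF n 1 (fun σ => σ v) := by
  refine ⟨fun i => if i = v then 1 else 0, 0, fun i => ?_, by simp, fun σ => ?_⟩
  · dsimp only; split_ifs <;> simp
  · simp [lin, hv]

/-- Smallness of the arguments in a po-history. -/
def USmall (N : ℕ) : ℕ ⊕ ℤ → Prop
  | .inl v => v < N
  | .inr c => c.natAbs ≤ N

theorem USmall.isF {N : ℕ} {u : ℕ ⊕ ℤ} (h : USmall N u) :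
    IsF N N (fun σ => Sum.elim σ id u) := by
  cases u with
  | inl v =>
    have hv : v < N := h
    exact (IsF.var hv).mono (by omega)
  | inr c => exact (IsF.const N c).mono h

theorem natAbs_le_encode (k : ℤ) : k.natAbs ≤ Encodable.encode k := by
  rcases k with k | k
  · change k ≤ 2 * k
    omega
  · change k + 1 ≤ 2 * k + 1
    omega

theorem coeffs_le : ∀ l : List (ℤ × ℕ), (l.map fun q => q.1.natAbs).sum ≤ Encodable.encode l
  | [] => by simp
  | (k, v) :: l => by
    have ih := coeffs_le l
    have h1 := natAbs_le_encode k
    have h2 : Encodable.encode ((k, v) :: l) =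
      (Nat.pair (Nat.pair (Encodable.encode k) v) (Encodable.encode l)).succ := rfl
    have h3 := Nat.add_le_pair (Nat.pair (Encodable.encode k) v) (Encodable.encode l)
    have h4 := Nat.left_le_pair (Encodable.encode k) v
    simp only [List.map_cons, List.sum_cons]
    omega

theorem mem_encode_lt {α : Type*} [Encodable α] {a : α} : ∀ {l : List α}, a ∈ l →
    Encodable.encode a < Encodable.encode l
  | b :: l, h => by
    have h2 : Encodable.encode (b :: l) =
      (Nat.pair (Encodable.encode b) (Encodable.encode l)).succ := rfl
    have h3 := Nat.add_le_pair (Encodable.encode b) (Encodable.encode l)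
    rcases List.mem_cons.1 h with h | h
    · subst h; omega
    · have := mem_encode_lt h; omega

theorem term_isF {N : ℕ} (t : LTm) (ht : t.enc ≤ N) (θ : ℕ → ℕ ⊕ ℤ) (hθ : ∀ v, USmall N (θ v)) :
    IsF N (N * N + N) (fun σ => t.eval (fun v => Sum.elim σ id (θ v))) := by
  have h1 : Encodable.encode t.coeffs ≤ N := (Nat.left_le_pair _ _).trans ht
  have h2 : Encodable.encode t.const ≤ N := (Nat.right_le_pair _ _).trans ht
  have h3 := (coeffs_le t.coeffs).trans h1
  have h4 := (natAbs_le_encode t.const).trans h2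
  have key : ∀ l : List (ℤ × ℕ), IsF N ((l.map fun q => q.1.natAbs).sum * N)
      (fun σ => (l.map fun q => q.1 * Sum.elim σ id (θ q.2)).sum) := by
    intro l
    induction l with
    | nil => simpa using IsF.const N 0
    | cons q l ih =>
      simp only [List.map_cons, List.sum_cons, add_mul]
      exact ((hθ q.2).isF.smul q.1).add ih
  exact ((key t.coeffs).add (IsF.const N t.const)).mono
    (Nat.add_le_add (Nat.mul_le_mul_right _ h3) h4)

/-- Agreement on the sign of all bounded forms. -/
def Agree (N : ℕ) (σ τ : ℕ → ℤ) : Prop :=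
  ∀ f, IsF N (2 * (N * N + N)) f → (0 < f σ ↔ 0 < f τ)

theorem Agree.lt {N : ℕ} {σ τ : ℕ → ℤ} (h : Agree N σ τ) {f g} (hf : IsF N (N * N + N) f)
    (hg : IsF N (N * N + N) g) : f σ < g σ ↔ f τ < g τ := by
  have := h _ ((hg.add (hf.smul (-1))).mono (by simp; omega))
  constructor
  · intro h; have := this.1 (by linarith); linarith
  · intro h; have := this.2 (by linarith); linarith

theorem Agree.le {N : ℕ} {σ τ : ℕ → ℤ} (h : Agree N σ τ) {f g} (hf : IsF N (N * N + N) f)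
    (hg : IsF N (N * N + N) g) : f σ ≤ g σ ↔ f τ ≤ g τ := by
  rw [← not_lt, ← not_lt, h.lt hg hf]

theorem Agree.eq {N : ℕ} {σ τ : ℕ → ℤ} (h : Agree N σ τ) {f g} (hf : IsF N (N * N + N) f)
    (hg : IsF N (N * N + N) g) : f σ = g σ ↔ f τ = g τ := by
  rw [le_antisymm_iff, le_antisymm_iff, h.le hf hg, h.le hg hf]

theorem mem_applySub (σ : ℕ → ℤ) (h : ZPoHistory) (k p : ℕ) (cs : List ℤ) :
    (p, cs) ∈ (applySub σ h).getD k ∅ ↔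
      ∃ e ∈ h.getD k ∅, e.1 = p ∧ e.2.map (Sum.elim σ id) = cs := by
  have : (applySub σ h).getD k ∅ =
      (h.getD k ∅).image fun e => (e.1, e.2.map (Sum.elim σ id)) := by
    unfold applySub
    simp only [List.getD_eq_getElem?_getD, List.getElem?_map]
    cases h[k]? <;> simp
  rw [this, Finset.mem_image]
  simp [Prod.ext_iff]

theorem updEnv_map (σ : ℕ → ℤ) (θ : ℕ → ℕ ⊕ ℤ) (us : List (ℕ ⊕ ℤ)) (xs : List ℕ) :
    updEnv (fun v => Sum.elim σ id (θ v)) xs (us.map (Sum.elim σ id)) =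
      fun v => Sum.elim σ id (((xs.zip us).lookup v).getD (θ v)) := by
  funext v
  unfold updEnv
  induction xs generalizing us with
  | nil => simp
  | cons x xs ih =>
    cases us with
    | nil => simp
    | cons u us =>
      simp only [List.map_cons, List.zip_cons_cons, List.lookup_cons]
      cases v == x
      · exact ih us
      · simp

theorem lookup_small {N : ℕ} (θ : ℕ → ℕ ⊕ ℤ) (hθ : ∀ v, USmall N (θ v)) (xs : List ℕ)
    (us : List (ℕ ⊕ ℤ)) (hus : ∀ u ∈ us, USmall N u) (v : ℕ) :
    USmall N (((xs.zip us).lookup v).getD (θ v)) := by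
  induction xs generalizing us with
  | nil => simpa using hθ v
  | cons x xs ih =>
    cases us with
    | nil => simpa using hθ v
    | cons u us =>
      simp only [List.zip_cons_cons, List.lookup_cons]
      cases v == x
      · exact ih us (fun u hu => hus u (by simp [hu]))
      · simpa using hus u (by simp)

theorem sat_all_iff (σ : ℕ → ℤ) (h : ZPoHistory) (i : ℕ) (θ : ℕ → ℕ ⊕ ℤ) (xs : List ℕ) (p : ℕ)
    (a : LFm) :
    LSat (applySub σ h) i (fun v => Sum.elim σ id (θ v)) (.all xs p a) ↔
      ∀ e ∈ h.getD (i - 1) ∅, e.1 = p → e.2.length = xs.length →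
        LSat (applySub σ h) i
          (fun v => Sum.elim σ id (((xs.zip e.2).lookup v).getD (θ v))) a := by
  simp only [LSat]
  constructor
  · intro H e he hp hl
    rw [← updEnv_map]
    exact H _ (by simpa using hl) ((mem_applySub ..).2 ⟨e, he, hp, rfl⟩)
  · intro H cs hl hm
    obtain ⟨e, he, hp, rfl⟩ := (mem_applySub ..).1 hm
    rw [updEnv_map]
    exact H e he hp (by simpa using hl)

theorem sat_transfer {N : ℕ} {σ τ : ℕ → ℤ} (hN : Agree N σ τ) (h : ZPoHistory)
    (hh : ∀ k, ∀ e ∈ h.getD k ∅, ∀ u ∈ e.2, USmall N u) (ψ : LFm) :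
    ψ.enc ≤ N → ∀ (i : ℕ) (θ : ℕ → ℕ ⊕ ℤ), (∀ v, USmall N (θ v)) →
      (LSat (applySub σ h) i (fun v => Sum.elim σ id (θ v)) ψ ↔
        LSat (applySub τ h) i (fun v => Sum.elim τ id (θ v)) ψ) := by
  induction ψ with
  | atom p ts =>
    intro hψ i θ hθ
    simp only [LSat, mem_applySub]
    have hts : ∀ t ∈ ts, t.enc ≤ N := by
      intro t ht
      have h1 : Encodable.encode (t.enc) < Encodable.encode (ts.map LTm.enc) :=
        mem_encode_lt (List.mem_map_of_mem ht)
      have h2 : Encodable.encode (ts.map LTm.enc) ≤ N :=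
        (Nat.right_le_pair _ _).trans ((Nat.right_le_pair _ _).trans hψ)
      exact h1.le.trans h2
    have key : ∀ (ts : List LTm) (us : List (ℕ ⊕ ℤ)), (∀ t ∈ ts, t.enc ≤ N) →
        (∀ u ∈ us, USmall N u) →
        (us.map (Sum.elim σ id) = ts.map (LTm.eval fun v => Sum.elim σ id (θ v)) ↔
        us.map (Sum.elim τ id) = ts.map (LTm.eval fun v => Sum.elim τ id (θ v))) := by
      intro ts
      induction ts with
      | nil => intro us _ _; simp
      | cons t ts ih =>
        intro us h1 h2
        cases us with
        | nil => simp
        | cons u us =>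
          simp only [List.map_cons, List.cons.injEq]
          rw [ih us (fun t ht => h1 t (by simp [ht])) (fun u hu => h2 u (by simp [hu])),
            hN.eq ((h2 u (by simp)).isF.mono (by nlinarith)) (term_isF t (h1 t (by simp)) θ hθ)]
    exact exists_congr fun e => and_congr_right fun he => and_congr_right fun _ =>
      key ts e.2 hts (hh _ e he)
  | eq s t =>
    intro hψ i θ hθ
    have hp := (Nat.right_le_pair _ _).trans hψ
    exact hN.eq (term_isF s ((Nat.left_le_pair _ _).trans hp) θ hθ)
      (term_isF t ((Nat.right_le_pair _ _).trans hp) θ hθ)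
  | le s t =>
    intro hψ i θ hθ
    have hp := (Nat.right_le_pair _ _).trans hψ
    exact hN.le (term_isF s ((Nat.left_le_pair _ _).trans hp) θ hθ)
      (term_isF t ((Nat.right_le_pair _ _).trans hp) θ hθ)
  | ge s t =>
    intro hψ i θ hθ
    have hp := (Nat.right_le_pair _ _).trans hψ
    exact hN.le (term_isF t ((Nat.right_le_pair _ _).trans hp) θ hθ)
      (term_isF s ((Nat.left_le_pair _ _).trans hp) θ hθ)
  | and a b iha ihb =>
    intro hψ i θ hθ
    have hp := (Nat.right_le_pair _ _).trans hψ
    exact and_congr (iha ((Nat.left_le_pair _ _).trans hp) i θ hθ)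
      (ihb ((Nat.right_le_pair _ _).trans hp) i θ hθ)
  | not a ih =>
    intro hψ i θ hθ
    exact not_congr (ih ((Nat.right_le_pair _ _).trans hψ) i θ hθ)
  | prev a ih =>
    intro hψ i θ hθ
    exact and_congr_right fun _ => ih ((Nat.right_le_pair _ _).trans hψ) (i - 1) θ hθ
  | since a b iha ihb =>
    intro hψ i θ hθ
    have hp := (Nat.right_le_pair _ _).trans hψ
    have ha := fun k => iha ((Nat.left_le_pair _ _).trans hp) k θ hθ
    have hb := fun k => ihb ((Nat.right_le_pair _ _).trans hp) k θ hθ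
    simp only [LSat, ha, hb]
  | all xs p a ih =>
    intro hψ i θ hθ
    have hp := (Nat.right_le_pair _ _).trans ((Nat.right_le_pair _ _).trans
      ((Nat.right_le_pair _ _).trans hψ))
    rw [sat_all_iff, sat_all_iff]
    exact forall_congr' fun e => forall_congr' fun he => forall_congr' fun _ =>
      forall_congr' fun _ => ih hp i _ (lookup_small θ hθ xs e.2 (hh _ e he))

theorem updEnv_agree (ρ ρ' : ℕ → ℤ) (xs : List ℕ) (cs : List ℤ) (hl : cs.length = xs.length)
    (v : ℕ) (h : v ∉ xs → ρ v = ρ' v) : updEnv ρ xs cs v = updEnv ρ' xs cs v := by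
  unfold updEnv
  induction xs generalizing cs with
  | nil => simpa using h
  | cons x xs ih =>
    cases cs with
    | nil => simp at hl
    | cons c cs =>
      simp only [List.zip_cons_cons, List.lookup_cons]
      rcases hv : v == x with _ | _
      · refine ih cs (by simpa using hl) fun h1 => h ?_
        simp only [List.mem_cons, not_or]
        exact ⟨by simpa using hv, h1⟩
      · simp

theorem term_congr (t : LTm) (ρ ρ' : ℕ → ℤ) (h : ∀ v ∈ t.vars, ρ v = ρ' v) :
    t.eval ρ = t.eval ρ' := by
  unfold LTm.eval
  congr 2
  refine List.map_congr_left fun q hq => ?_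
  rw [h q.2 (List.mem_map_of_mem hq)]

theorem sat_congr (h : List ZSession) (ψ : LFm) : ∀ (i : ℕ) (ρ ρ' : ℕ → ℤ),
    (∀ v ∈ ψ.fv, ρ v = ρ' v) → (LSat h i ρ ψ ↔ LSat h i ρ' ψ) := by
  induction ψ with
  | atom p ts =>
    intro i ρ ρ' hv
    simp only [LSat]
    rw [List.map_congr_left fun t ht => term_congr t ρ ρ' fun v hv' =>
      hv v (List.mem_flatMap.2 ⟨t, ht, hv'⟩)]
  | eq s t =>
    intro i ρ ρ' hv
    simp only [LFm.fv, List.mem_append] at hv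
    simp only [LSat]
    rw [term_congr s ρ ρ' fun v h => hv v (.inl h), term_congr t ρ ρ' fun v h => hv v (.inr h)]
  | le s t =>
    intro i ρ ρ' hv
    simp only [LFm.fv, List.mem_append] at hv
    simp only [LSat]
    rw [term_congr s ρ ρ' fun v h => hv v (.inl h), term_congr t ρ ρ' fun v h => hv v (.inr h)]
  | ge s t =>
    intro i ρ ρ' hv
    simp only [LFm.fv, List.mem_append] at hv
    simp only [LSat]
    rw [term_congr s ρ ρ' fun v h => hv v (.inl h), term_congr t ρ ρ' fun v h => hv v (.inr h)]
  | and a b iha ihb =>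
    intro i ρ ρ' hv
    simp only [LFm.fv, List.mem_append] at hv
    exact and_congr (iha i ρ ρ' fun v h => hv v (.inl h)) (ihb i ρ ρ' fun v h => hv v (.inr h))
  | not a ih =>
    intro i ρ ρ' hv
    exact not_congr (ih i ρ ρ' hv)
  | prev a ih =>
    intro i ρ ρ' hv
    exact and_congr_right fun _ => ih (i - 1) ρ ρ' hv
  | since a b iha ihb =>
    intro i ρ ρ' hv
    simp only [LFm.fv, List.mem_append] at hv
    have ha := fun k => iha k ρ ρ' fun v h => hv v (.inl h)
    have hb := fun k => ihb k ρ ρ' fun v h => hv v (.inr h)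
    simp only [LSat, ha, hb]
  | all xs p a ih =>
    intro i ρ ρ' hv
    simp only [LSat]
    refine forall_congr' fun cs => forall_congr' fun hl => forall_congr' fun _ => ?_
    refine ih i _ _ fun v hv' => updEnv_agree _ _ _ _ hl v fun hx => hv v ?_
    simp [LFm.fv, hv', hx]

end PTL

/-! ### Part C: an evaluator on codes -/

namespace PTL

/-- Concrete histories as lists. -/
abbrev CHist := List (List (ℕ × List ℤ))
/-- Environments as association lists. -/
abbrev CEnv := List (ℕ × ℤ)
/-- An evaluation task: code of a formula, index, environment. -/
abbrev CTask := ℕ × ℕ × CEnv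

/-- Value of a variable in an association list. -/
def look (env : CEnv) (v : ℕ) : ℤ := (env.lookup v).getD 0

/-- Evaluate a coded linear term. -/
def evTerm (env : CEnv) (tc : ℕ) : ℤ :=
  ((Encodable.decode (α := List (ℤ × ℕ)) tc.unpair.1).getD []).foldr
    (fun q acc => q.1 * look env q.2 + acc) ((Encodable.decode (α := ℤ) tc.unpair.2).getD 0)

/-- The session at (one-based) index `i`. -/
def sess (H : CHist) (i : ℕ) : List (ℕ × List ℤ) := H.getD (i - 1) []

/-- Extend an environment. -/
def ext (xs : List ℕ) (cs : List ℤ) (env : CEnv) : CEnv :=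
  (List.range xs.length).map (fun j => (xs.getD j 0, cs.getD j 0)) ++ env

/-- Decode a list of naturals. -/
def dlist (n : ℕ) : List ℕ := (Encodable.decode (α := List ℕ) n).getD []

/-- The recursive calls for the quantifier. -/
def allKids (S : List (ℕ × List ℤ)) (pl i : ℕ) (env : CEnv) : List CTask :=
  S.flatMap fun e =>
    if e.1 = pl.unpair.2.unpair.1 ∧ e.2.length = (dlist pl.unpair.1).length then
      [(pl.unpair.2.unpair.2, i, ext (dlist pl.unpair.1) e.2 env)]
    else []

/-- The recursive calls. -/
def kids (H : CHist) (b : CTask) : List CTask :=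
  let c := b.1
  let i := b.2.1
  let env := b.2.2
  let tag := c.unpair.1
  let pl := c.unpair.2
  if tag = 4 then [(pl.unpair.1, i, env), (pl.unpair.2, i, env)]
  else if tag = 5 then [(pl, i, env)]
  else if tag = 6 then (if 1 < i then [(pl, i - 1, env)] else [])
  else if tag = 7 then
    (if i = 0 then [] else [(pl.unpair.2, i, env), (pl.unpair.1, i, env), (c, i - 1, env)])
  else if tag = 8 then allKids (sess H i) pl i env
  else []

/-- Combine the results of the recursive calls. -/
def comb (H : CHist) (q : CTask × List Bool) : Bool :=
  let c := q.1.1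
  let i := q.1.2.1
  let env := q.1.2.2
  let vs := q.2
  let tag := c.unpair.1
  let pl := c.unpair.2
  if tag = 0 then decide (∃ e ∈ sess H i, e = (pl.unpair.1, (dlist pl.unpair.2).map (evTerm env)))
  else if tag = 1 then decide (evTerm env pl.unpair.1 = evTerm env pl.unpair.2)
  else if tag = 2 then decide (evTerm env pl.unpair.1 ≤ evTerm env pl.unpair.2)
  else if tag = 3 then decide (evTerm env pl.unpair.2 ≤ evTerm env pl.unpair.1)
  else if tag = 4 then (vs.getD 0 false && vs.getD 1 false)
  else if tag = 5 then !(vs.getD 0 false)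
  else if tag = 6 then vs.getD 0 false
  else if tag = 7 then (vs.getD 0 false || (vs.getD 1 false && vs.getD 2 false))
  else vs.foldr (fun a b => a && b) true

theorem unpair_sum (c : ℕ) : c.unpair.1 + c.unpair.2 ≤ c := by
  have := Nat.add_le_pair c.unpair.1 c.unpair.2
  rwa [Nat.pair_unpair] at this

theorem kids_lt (H : CHist) (b b' : CTask) (h : b' ∈ kids H b) : b'.1 + b'.2.1 < b.1 + b.2.1 := by
  obtain ⟨c, i, env⟩ := b
  have h1 := unpair_sum c
  have h2 := unpair_sum c.unpair.2
  have h3 := unpair_sum c.unpair.2.unpair.2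
  simp only [kids] at h
  split_ifs at h with h4 h5 h6 h7 h8 h9 h10
  · simp only [List.mem_cons, List.not_mem_nil, or_false] at h
    rcases h with rfl | rfl <;> (dsimp only; omega)
  · simp only [List.mem_cons, List.not_mem_nil, or_false] at h
    subst h; dsimp only; omega
  · simp only [List.mem_cons, List.not_mem_nil, or_false] at h
    subst h; dsimp only; omega
  · simp at h
  · simp at h
  · simp only [List.mem_cons, List.not_mem_nil, or_false] at h
    rcases h with rfl | rfl | rfl <;> (dsimp only; omega)
  · simp only [allKids, List.mem_flatMap] at h
    obtain ⟨e, _, he⟩ := h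
    split_ifs at he
    · simp only [List.mem_cons, List.not_mem_nil, or_false] at he
      subst he; dsimp only; omega
    · simp at he
  · simp at h

/-- The evaluator. -/
def ev (H : CHist) (b : CTask) : Bool :=
  comb H (b, (kids H b).attach.map fun b' => ev H b'.1)
termination_by b.1 + b.2.1
decreasing_by exact kids_lt H b b'.1 b'.2

theorem ev_eq (H : CHist) (b : CTask) : ev H b = comb H (b, (kids H b).map (ev H)) := by
  rw [ev]
  simp

theorem evTerm_enc (env : CEnv) (t : LTm) : evTerm env t.enc = t.eval (look env) := by
  unfold evTerm LTm.enc LTm.eval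
  simp only [Nat.unpair_pair, Encodable.encodek, Option.getD_some]
  generalize t.coeffs = l
  induction l with
  | nil => simp
  | cons q l ih => simp only [List.foldr_cons, ih, List.map_cons, List.sum_cons]; ring

theorem dlist_encode (l : List ℕ) : dlist (Encodable.encode l) = l := by simp [dlist]

theorem look_ext (xs : List ℕ) (cs : List ℤ) (env : CEnv) (hl : cs.length = xs.length) :
    look (ext xs cs env) = updEnv (look env) xs cs := by
  have : (List.range xs.length).map (fun j => (xs.getD j 0, cs.getD j 0)) = xs.zip cs := by
    apply List.ext_getElem
    · simp [hl]
    · intro n h1 h2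
      simp at h1 h2
      simp [h1, h2]
  funext v
  unfold look ext updEnv
  rw [this, List.lookup_append]
  cases (xs.zip cs).lookup v <;> rfl

theorem mem_sess (H : CHist) (i : ℕ) (x : ℕ × List ℤ) :
    x ∈ (H.map List.toFinset).getD (i - 1) ∅ ↔ x ∈ sess H i := by
  unfold sess
  simp only [List.getD_eq_getElem?_getD, List.getElem?_map]
  cases H[i - 1]? <;> simp

theorem foldr_and (l : List Bool) : l.foldr (fun a b => a && b) true = true ↔ ∀ b ∈ l, b = true := by
  induction l with
  | nil => simp
  | cons a l ih => simp [ih]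

theorem since_unfold (h : List ZSession) (i : ℕ) (ρ : ℕ → ℤ) (a b : LFm) :
    LSat h i ρ (.since a b) ↔ i ≠ 0 ∧ (LSat h i ρ b ∨
      (LSat h i ρ a ∧ LSat h (i - 1) ρ (.since a b))) := by
  simp only [LSat]
  constructor
  · rintro ⟨j, h1, h2, h3, h4⟩
    refine ⟨by omega, ?_⟩
    rcases h2.lt_or_eq with h | h
    · exact .inr ⟨h4 i h le_rfl, j, h1, by omega, h3, fun k hk hk' => h4 k hk (by omega)⟩
    · subst h; exact .inl h3
  · rintro ⟨h0, h | ⟨h1, j, h2, h3, h4, h5⟩⟩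
    · exact ⟨i, by omega, le_rfl, h, fun k hk hk' => by omega⟩
    · refine ⟨j, h2, by omega, h4, fun k hk hk' => ?_⟩
      rcases hk'.lt_or_eq with h | h
      · exact h5 k hk (by omega)
      · subst h; exact h1

theorem ev_correct (H : CHist) (ψ : LFm) : ∀ (i : ℕ) (env : CEnv),
    ev H (ψ.enc, i, env) = true ↔ LSat (H.map List.toFinset) i (look env) ψ := by
  induction ψ with
  | atom p ts =>
    intro i env
    rw [ev_eq]
    simp only [comb, LFm.enc, Nat.unpair_pair, dlist_encode, LSat, mem_sess]
    have : (evTerm env ∘ LTm.enc) = LTm.eval (look env) := by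
      funext t; exact evTerm_enc env t
    simp [this]
  | eq s t =>
    intro i env
    rw [ev_eq]
    simp [comb, LFm.enc, LSat, evTerm_enc]
  | le s t =>
    intro i env
    rw [ev_eq]
    simp [comb, LFm.enc, LSat, evTerm_enc]
  | ge s t =>
    intro i env
    rw [ev_eq]
    simp [comb, LFm.enc, LSat, evTerm_enc]
  | and a b iha ihb =>
    intro i env
    rw [ev_eq]
    simp [comb, kids, LFm.enc, LSat, iha, ihb]
  | not a ih =>
    intro i env
    rw [ev_eq]
    simp [comb, kids, LFm.enc, LSat, ← ih]
  | prev a ih =>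
    intro i env
    rw [ev_eq]
    by_cases hi : 1 < i
    · simp [comb, kids, LFm.enc, LSat, ih, hi]
    · simp [comb, kids, LFm.enc, LSat, hi]
  | since a b iha ihb =>
    intro i env
    induction i with
    | zero =>
      rw [ev_eq, since_unfold]
      simp [comb, kids, LFm.enc]
    | succ i ihi =>
      rw [ev_eq, since_unfold]
      simp only [LFm.enc] at ihi
      simp [comb, kids, LFm.enc, iha, ihb, ihi]
  | all xs p a ih =>
    intro i env
    rw [ev_eq]
    simp only [LSat, mem_sess]
    simp only [comb, kids, allKids, LFm.enc, Nat.unpair_pair, dlist_encode]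
    norm_num
    rw [foldr_and]
    simp only [List.mem_flatMap, List.mem_map]
    constructor
    · intro h cs hl hm
      rw [← look_ext xs cs env hl, ← ih]
      refine h _ ⟨_, ⟨(p, cs), hm, ?_⟩, rfl⟩
      simp [hl]
    · rintro h _ ⟨b', ⟨⟨p', cs⟩, hm, hb⟩, rfl⟩
      split_ifs at hb with hc
      · simp only [List.mem_cons, List.not_mem_nil, or_false] at hb
        obtain ⟨rfl, hl⟩ := hc
        subst hb
        rw [ih, look_ext xs cs env hl]
        exact h cs hl hm
      · simp at hb

end PTL

/-! ### Part D: primitive recursiveness -/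

namespace PTL

open Primrec

theorem encode_ofNat (n : ℕ) : Encodable.encode (n : ℤ) = 2 * n := rfl
theorem encode_negSucc (n : ℕ) : Encodable.encode (Int.negSucc n) = 2 * n + 1 := rfl

theorem enc_int_primrec : Primrec (fun z : ℤ => Encodable.encode z) := Primrec.encode

theorem primrec_toNat : Primrec Int.toNat := by
  have h : Primrec (fun z : ℤ => if Encodable.encode z % 2 = 0 then Encodable.encode z / 2 else 0) :=
    Primrec.ite (Primrec.eq.comp (nat_mod.comp enc_int_primrec (const 2)) (const 0))
      (nat_div.comp enc_int_primrec (const 2)) (const 0)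
  refine h.of_eq fun z => ?_
  rcases z with n | n
  · have : Encodable.encode (Int.ofNat n) = 2 * n := rfl
    rw [this]; simp
  · rw [encode_negSucc]
    have : (2 * n + 1) % 2 = 1 := by omega
    simp [this]

theorem primrec_negToNat : Primrec (fun z : ℤ => (-z).toNat) := by
  have h : Primrec (fun z : ℤ => if Encodable.encode z % 2 = 0 then 0
      else Encodable.encode z / 2 + 1) :=
    Primrec.ite (Primrec.eq.comp (nat_mod.comp enc_int_primrec (const 2)) (const 0)) (const 0)
      (succ.comp (nat_div.comp enc_int_primrec (const 2)))
  refine h.of_eq fun z => ?_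
  rcases z with n | n
  · have : Encodable.encode (Int.ofNat n) = 2 * n := rfl
    rw [this]; simp
  · rw [encode_negSucc]
    have : (2 * n + 1) % 2 = 1 := by omega
    simp [this, Int.neg_negSucc]
    omega

theorem natSub_aux (m n : ℕ) : (if n ≤ m then 2 * (m - n) else 2 * (n - m - 1) + 1) =
    Encodable.encode ((m : ℤ) - (n : ℤ)) := by
  split_ifs with hmn
  · obtain ⟨k, rfl⟩ := Nat.exists_eq_add_of_le hmn
    have : ((n + k : ℕ) : ℤ) - n = (k : ℕ) := by push_cast; ring
    rw [this, encode_ofNat]; congr 1; omega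
  · obtain ⟨k, rfl⟩ := Nat.exists_eq_add_of_lt (not_le.1 hmn)
    have : (m : ℤ) - (m + k + 1 : ℕ) = Int.negSucc k := by
      rw [Int.negSucc_eq]; push_cast; ring
    rw [this, encode_negSucc]; congr 2; omega

theorem primrec_natSub : Primrec₂ (fun m n : ℕ => (m : ℤ) - n) := by
  have h : Primrec (fun p : ℕ × ℕ => if p.2 ≤ p.1 then 2 * (p.1 - p.2)
      else 2 * (p.2 - p.1 - 1) + 1) :=
    Primrec.ite (nat_le.comp snd fst) (nat_mul.comp (const 2) (nat_sub.comp fst snd))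
      (succ.comp (nat_mul.comp (const 2) (nat_sub.comp (nat_sub.comp snd fst) (const 1))))
  have h2 : Primrec (fun p : ℕ × ℕ => (p.1 : ℤ) - (p.2 : ℤ)) := by
    refine Primrec.encode_iff.1 (h.of_eq fun p => ?_)
    exact natSub_aux p.1 p.2
  exact h2

theorem int_split (z : ℤ) : z = (z.toNat : ℤ) - ((-z).toNat : ℤ) := by omega

theorem primrec_intAdd : Primrec₂ (fun a b : ℤ => a + b) := by
  have h : Primrec (fun p : ℤ × ℤ => ((p.1.toNat + p.2.toNat : ℕ) : ℤ) -
      (((-p.1).toNat + (-p.2).toNat : ℕ) : ℤ)) :=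
    primrec_natSub.comp (nat_add.comp (primrec_toNat.comp fst) (primrec_toNat.comp snd))
      (nat_add.comp (primrec_negToNat.comp fst) (primrec_negToNat.comp snd))
  have h2 : Primrec (fun p : ℤ × ℤ => p.1 + p.2) := h.of_eq fun p => by omega
  exact h2

theorem primrec_intMul : Primrec₂ (fun a b : ℤ => a * b) := by
  have h : Primrec (fun p : ℤ × ℤ =>
      ((p.1.toNat * p.2.toNat + (-p.1).toNat * (-p.2).toNat : ℕ) : ℤ) -
      ((p.1.toNat * (-p.2).toNat + (-p.1).toNat * p.2.toNat : ℕ) : ℤ)) :=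
    primrec_natSub.comp
      (nat_add.comp (nat_mul.comp (primrec_toNat.comp fst) (primrec_toNat.comp snd))
        (nat_mul.comp (primrec_negToNat.comp fst) (primrec_negToNat.comp snd)))
      (nat_add.comp (nat_mul.comp (primrec_toNat.comp fst) (primrec_negToNat.comp snd))
        (nat_mul.comp (primrec_negToNat.comp fst) (primrec_toNat.comp snd)))
  have h2 : Primrec (fun p : ℤ × ℤ => p.1 * p.2) := by
    refine h.of_eq fun p => ?_
    conv_rhs => rw [int_split p.1, int_split p.2]
    push_cast; ring
  exact h2

theorem primrec_intLe : PrimrecRel (fun a b : ℤ => a ≤ b) := by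
  have h : PrimrecRel (fun a b : ℤ => a.toNat + (-b).toNat ≤ b.toNat + (-a).toNat) :=
    PrimrecRel.comp nat_le
      (nat_add.comp (primrec_toNat.comp fst) (primrec_negToNat.comp snd))
      (nat_add.comp (primrec_toNat.comp snd) (primrec_negToNat.comp fst))
  exact h.of_eq fun a b => by omega

theorem primrec_look : Primrec₂ look :=
  option_getD.comp (listLookup.comp snd fst) (const 0)

theorem primrec_u1 : Primrec (fun n : ℕ => n.unpair.1) := fst.comp unpair
theorem primrec_u2 : Primrec (fun n : ℕ => n.unpair.2) := snd.comp unpair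

theorem primrec_dlist : Primrec dlist :=
  option_getD.comp Primrec.decode (const [])

theorem primrec_evTerm : Primrec₂ evTerm := by
  refine list_foldr (f := fun p : CEnv × ℕ =>
    (Encodable.decode (α := List (ℤ × ℕ)) p.2.unpair.1).getD [])
    (g := fun p : CEnv × ℕ => (Encodable.decode (α := ℤ) p.2.unpair.2).getD 0)
    (h := fun p q => q.1.1 * look p.1 q.1.2 + q.2) ?_ ?_ ?_
  · exact option_getD.comp (Primrec.decode.comp (primrec_u1.comp snd)) (const [])
  · exact option_getD.comp (Primrec.decode.comp (primrec_u2.comp snd)) (const 0)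
  · exact primrec_intAdd.comp
      (primrec_intMul.comp (fst.comp (fst.comp snd))
        (primrec_look.comp (fst.comp fst) (snd.comp (fst.comp snd))))
      (snd.comp snd)

theorem primrec_sess : Primrec₂ sess :=
  (list_getD []).comp fst (nat_sub.comp snd (const 1))

theorem primrec_ext : Primrec (fun p : List ℕ × List ℤ × CEnv => ext p.1 p.2.1 p.2.2) := by
  refine list_append.comp (list_map (list_range.comp (list_length.comp fst)) ?_) (snd.comp snd)
  exact Primrec.pair ((list_getD 0).comp (fst.comp fst) snd)
    ((list_getD 0).comp (fst.comp (snd.comp fst)) snd)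

theorem primrec_allKids : Primrec (fun p : List (ℕ × List ℤ) × ℕ × ℕ × CEnv =>
    allKids p.1 p.2.1 p.2.2.1 p.2.2.2) := by
  refine list_flatMap fst ?_
  have hpl : Primrec (fun q : (List (ℕ × List ℤ) × ℕ × ℕ × CEnv) × (ℕ × List ℤ) => q.1.2.1) :=
    fst.comp (snd.comp fst)
  have hx : Primrec (fun q : (List (ℕ × List ℤ) × ℕ × ℕ × CEnv) × (ℕ × List ℤ) =>
    dlist q.1.2.1.unpair.1) := primrec_dlist.comp (primrec_u1.comp hpl)
  refine Primrec.ite (PrimrecPred.and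
    (Primrec.eq.comp (fst.comp snd) (primrec_u1.comp (primrec_u2.comp hpl)))
    (Primrec.eq.comp (list_length.comp (snd.comp snd)) (list_length.comp hx))) ?_ (const [])
  refine list_cons.comp (Primrec.pair (primrec_u2.comp (primrec_u2.comp hpl))
    (Primrec.pair (fst.comp (snd.comp (snd.comp fst))) ?_)) (const [])
  exact primrec_ext.comp (Primrec.pair hx (Primrec.pair (snd.comp snd)
    (snd.comp (snd.comp (snd.comp fst)))))

theorem primrec_kids : Primrec₂ kids := by
  have hc : Primrec (fun p : CHist × CTask => p.2.1) := fst.comp snd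
  have hi : Primrec (fun p : CHist × CTask => p.2.2.1) := fst.comp (snd.comp snd)
  have he : Primrec (fun p : CHist × CTask => p.2.2.2) := snd.comp (snd.comp snd)
  have ht := primrec_u1.comp hc
  have hp := primrec_u2.comp hc
  have tg : ∀ k : ℕ, PrimrecPred (fun p : CHist × CTask => p.2.1.unpair.1 = k) :=
    fun k => Primrec.eq.comp ht (const k)
  have i1 : Primrec (fun p : CHist × CTask => p.2.2.1 - 1) := nat_sub.comp hi (const 1)
  have one : ∀ {f : CHist × CTask → CTask}, Primrec f → Primrec (fun p => [f p]) :=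
    fun hf => list_cons.comp hf (const [])
  have hs : Primrec (fun p : CHist × CTask => sess p.1 p.2.2.1) := primrec_sess.comp fst hi
  have hq : Primrec (fun p : CHist × CTask =>
      (sess p.1 p.2.2.1, p.2.1.unpair.2, p.2.2.1, p.2.2.2)) :=
    Primrec.pair hs (Primrec.pair hp (Primrec.pair hi he))
  have h8 : Primrec (fun p : CHist × CTask =>
      allKids (sess p.1 p.2.2.1) p.2.1.unpair.2 p.2.2.1 p.2.2.2) := by
    have := primrec_allKids.comp hq
    exact this
  refine Primrec.ite (tg 4) (list_cons.comp (Primrec.pair (primrec_u1.comp hp) (Primrec.pair hi he))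
    (one (Primrec.pair (primrec_u2.comp hp) (Primrec.pair hi he)))) ?_
  refine Primrec.ite (tg 5) (one (Primrec.pair hp (Primrec.pair hi he))) ?_
  refine Primrec.ite (tg 6) (Primrec.ite (nat_lt.comp (const 1) hi)
    (one (Primrec.pair hp (Primrec.pair i1 he))) (const [])) ?_
  refine Primrec.ite (tg 7) (Primrec.ite (Primrec.eq.comp hi (const 0)) (const []) ?_) ?_
  · exact list_cons.comp (Primrec.pair (primrec_u2.comp hp) (Primrec.pair hi he))
      (list_cons.comp (Primrec.pair (primrec_u1.comp hp) (Primrec.pair hi he))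
      (one (Primrec.pair hc (Primrec.pair i1 he))))
  · refine Primrec.ite (tg 8) ?_ (const [])
    exact h8

theorem primrec_comb : Primrec₂ comb := by
  have hc : Primrec (fun p : CHist × (CTask × List Bool) => p.2.1.1) := fst.comp (fst.comp snd)
  have hi : Primrec (fun p : CHist × (CTask × List Bool) => p.2.1.2.1) :=
    fst.comp (snd.comp (fst.comp snd))
  have he : Primrec (fun p : CHist × (CTask × List Bool) => p.2.1.2.2) :=
    snd.comp (snd.comp (fst.comp snd))
  have hv : Primrec (fun p : CHist × (CTask × List Bool) => p.2.2) := snd.comp snd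
  have ht := primrec_u1.comp hc
  have hp := primrec_u2.comp hc
  have tg : ∀ k : ℕ, PrimrecPred (fun p : CHist × (CTask × List Bool) => p.2.1.1.unpair.1 = k) :=
    fun k => Primrec.eq.comp ht (const k)
  have vk : ∀ k : ℕ, Primrec (fun p : CHist × (CTask × List Bool) => p.2.2.getD k false) :=
    fun k => (list_getD false).comp hv (const k)
  have t1 := primrec_evTerm.comp he (primrec_u1.comp hp)
  have t2 := primrec_evTerm.comp he (primrec_u2.comp hp)
  refine Primrec.ite (tg 0) (PrimrecPred.decide ?_) ?_
  · have h1 : PrimrecRel fun (L : List (ℕ × List ℤ)) b => ∃ a ∈ L, a = b :=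
      PrimrecRel.exists_mem_list Primrec.eq
    refine PrimrecRel.comp h1 (primrec_sess.comp fst hi) (Primrec.pair (primrec_u1.comp hp) ?_)
    exact list_map (primrec_dlist.comp (primrec_u2.comp hp))
      (primrec_evTerm.comp (he.comp fst) snd)
  refine Primrec.ite (tg 1) (PrimrecPred.decide (Primrec.eq.comp t1 t2)) ?_
  refine Primrec.ite (tg 2) (PrimrecPred.decide (PrimrecRel.comp primrec_intLe t1 t2)) ?_
  refine Primrec.ite (tg 3) (PrimrecPred.decide (PrimrecRel.comp primrec_intLe t2 t1)) ?_
  refine Primrec.ite (tg 4) (Primrec.and.comp (vk 0) (vk 1)) ?_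
  refine Primrec.ite (tg 5) (Primrec.not.comp (vk 0)) ?_
  refine Primrec.ite (tg 6) (vk 0) ?_
  refine Primrec.ite (tg 7) (Primrec.or.comp (vk 0) (Primrec.and.comp (vk 1) (vk 2))) ?_
  have ha : Primrec₂ (fun (_ : CHist × (CTask × List Bool)) (q : Bool × Bool) => q.1 && q.2) :=
    Primrec.and.comp (fst.comp snd) (snd.comp snd)
  exact list_foldr hv (const true) ha

theorem primrec_ev : Primrec₂ ev := by
  refine nat_omega_rec ev (m := fun _ b => b.1 + b.2.1) (l := kids)
    (g := fun H q => some (comb H q)) ?_ primrec_kids (option_some.comp₂ primrec_comb)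
    (fun H b b' h => kids_lt H b b' h) (fun H b => by rw [← ev_eq])
  exact nat_add.comp (fst.comp snd) (fst.comp (snd.comp snd))

theorem primrec_factorial : Primrec Nat.factorial := by
  have h : Primrec (Nat.rec 1 (fun n r => (n + 1) * r) : ℕ → ℕ) :=
    nat_rec₁ 1 (nat_mul.comp (succ.comp fst) snd)
  refine h.of_eq fun n => ?_
  induction n with
  | zero => rfl
  | succ n ih => rw [Nat.factorial_succ, ← ih]

theorem primrec_Bd : Primrec (fun p : ℕ × ℕ × ℕ => Bd p.1 p.2.1 p.2.2) := by
  have hF : Primrec (fun p : ℕ × ℕ × ℕ => p.2.1.factorial) := primrec_factorial.comp (fst.comp snd)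
  have hK : Primrec (fun p : ℕ × ℕ × ℕ => p.2.1.factorial * p.2.1) :=
    nat_mul.comp hF (fst.comp snd)
  have hM : Primrec (fun p : ℕ × ℕ × ℕ => p.2.1.factorial * p.2.2) :=
    nat_mul.comp hF (snd.comp snd)
  refine nat_omega_rec' (fun p : ℕ × ℕ × ℕ => Bd p.1 p.2.1 p.2.2) (m := fun p => p.1)
    (l := fun p => if p.1 = 0 then [] else
      [(p.1 - 1, 2 * (p.2.1.factorial * p.2.1) + p.2.1.factorial * p.2.2,
        p.2.1.factorial * p.2.2)])
    (g := fun p vs => some (if p.1 = 0 then 0 else vs.getD 0 0 +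
      ((p.2.1.factorial * p.2.1) * (p.1 - 1) * vs.getD 0 0
      + p.2.1.factorial * p.2.1 + p.2.1.factorial * p.2.2))) fst ?_ ?_ ?_ ?_
  · refine Primrec.ite (Primrec.eq.comp fst (const 0)) (const []) (list_cons.comp ?_ (const []))
    exact Primrec.pair (nat_sub.comp fst (const 1))
      (Primrec.pair (nat_add.comp (nat_mul.comp (const 2) hK) hM) hM)
  · have hv : Primrec (fun q : (ℕ × ℕ × ℕ) × List ℕ => q.2.getD 0 0) :=
      (list_getD 0).comp snd (const 0)
    refine option_some.comp (Primrec.ite (Primrec.eq.comp (fst.comp fst) (const 0)) (const 0) ?_)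
    exact nat_add.comp hv (nat_add.comp (nat_add.comp (nat_mul.comp (nat_mul.comp (hK.comp fst)
      (nat_sub.comp (fst.comp fst) (const 1))) hv) (hK.comp fst)) (hM.comp fst))
  · rintro ⟨n, K, M⟩ b' hb
    dsimp only at hb
    split_ifs at hb with h
    · simp at hb
    · simp only [List.mem_cons, List.not_mem_nil, or_false] at hb
      subst hb; dsimp only; omega
  · rintro ⟨n, K, M⟩
    cases n with
    | zero => simp [Bd]
    | succ n => simp [Bd]

/-- Instantiate a po-history (as lists of lists). -/
def inst (τ : ℕ → ℤ) (L : List (List (ℕ × List (ℕ ⊕ ℤ)))) : CHist :=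
  L.map fun s => s.map fun e => (e.1, e.2.map (Sum.elim τ id))

/-- The `v`-th shifted digit of `m` in base `2 * B + 1`. -/
def dig (B m v : ℕ) : ℤ := (((m / (2 * B + 1) ^ v) % (2 * B + 1) : ℕ) : ℤ) - (B : ℕ)

theorem primrec_pow : Primrec₂ (fun a b : ℕ => a ^ b) :=
  Primrec₂.unpaired'.1 Nat.Primrec.pow

theorem primrec_dig : Primrec (fun p : (ℕ × ℕ) × ℕ => dig p.1.1 p.1.2 p.2) := by
  have hb : Primrec (fun p : (ℕ × ℕ) × ℕ => 2 * p.1.1 + 1) :=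
    succ.comp (nat_mul.comp (const 2) (fst.comp fst))
  exact primrec_natSub.comp (nat_mod.comp (nat_div.comp (snd.comp fst)
    (primrec_pow.comp hb snd)) hb) (fst.comp fst)

theorem primrec_arg : Primrec₂ (fun (q : ℕ × ℕ) (u : ℕ ⊕ ℤ) =>
    Sum.elim (dig q.1 q.2) id u) := by
  have hg : Primrec₂ (fun (p : (ℕ × ℕ) × (ℕ ⊕ ℤ)) (v : ℕ) => dig p.1.1 p.1.2 v) :=
    primrec_dig.comp (Primrec.pair (fst.comp fst) snd)
  have hh : Primrec₂ (fun (_ : (ℕ × ℕ) × (ℕ ⊕ ℤ)) (c : ℤ) => c) := snd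
  have hf : Primrec (fun p : (ℕ × ℕ) × (ℕ ⊕ ℤ) => p.2) := snd
  have h := sumCasesOn hf hg hh
  have h2 : Primrec (fun p : (ℕ × ℕ) × (ℕ ⊕ ℤ) => Sum.elim (dig p.1.1 p.1.2) id p.2) := by
    refine h.of_eq fun p => ?_
    obtain ⟨q, v | c⟩ := p <;> rfl
  exact h2

theorem primrec_args : Primrec₂ (fun (q : ℕ × ℕ) (us : List (ℕ ⊕ ℤ)) =>
    us.map (Sum.elim (dig q.1 q.2) id)) := by
  have hg : Primrec₂ (fun (p : (ℕ × ℕ) × List (ℕ ⊕ ℤ)) (u : ℕ ⊕ ℤ) =>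
      Sum.elim (dig p.1.1 p.1.2) id u) := primrec_arg.comp (fst.comp fst) snd
  exact list_map snd hg

theorem primrec_instE : Primrec₂ (fun (q : ℕ × ℕ) (e : ℕ × List (ℕ ⊕ ℤ)) =>
    (e.1, e.2.map (Sum.elim (dig q.1 q.2) id))) :=
  Primrec.pair (fst.comp snd) (primrec_args.comp fst (snd.comp snd))

theorem primrec_instS : Primrec₂ (fun (q : ℕ × ℕ) (s : List (ℕ × List (ℕ ⊕ ℤ))) =>
    s.map fun e => (e.1, e.2.map (Sum.elim (dig q.1 q.2) id))) := by
  have hg : Primrec₂ (fun (p : (ℕ × ℕ) × List (ℕ × List (ℕ ⊕ ℤ))) (e : ℕ × List (ℕ ⊕ ℤ)) =>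
      (e.1, e.2.map (Sum.elim (dig p.1.1 p.1.2) id))) := primrec_instE.comp (fst.comp fst) snd
  exact list_map snd hg

theorem primrec_inst : Primrec₂ (fun (q : ℕ × ℕ) (L : List (List (ℕ × List (ℕ ⊕ ℤ)))) =>
    inst (dig q.1 q.2) L) := by
  have hg : Primrec₂ (fun (p : (ℕ × ℕ) × List (List (ℕ × List (ℕ ⊕ ℤ))))
      (s : List (ℕ × List (ℕ ⊕ ℤ))) =>
      s.map fun e => (e.1, e.2.map (Sum.elim (dig p.1.1 p.1.2) id))) :=
    primrec_instS.comp (fst.comp fst) snd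
  exact list_map snd hg

/-- The numerical bound attached to an input code. -/
def bnd (n : ℕ) : ℕ := Bd (n + 1) (2 * ((n + 1) * (n + 1) + (n + 1))) 1

theorem primrec_bnd : Primrec bnd :=
  primrec_Bd.comp (Primrec.pair succ (Primrec.pair (nat_mul.comp (const 2)
    (nat_add.comp (nat_mul.comp succ succ) succ)) (const 1)))

/-- The check for a given candidate `m`. -/
def chk (m n : ℕ) : Bool :=
  ev (inst (dig (bnd n) m)
    ((Encodable.decode (α := List (List (ℕ × List (ℕ ⊕ ℤ)))) n.unpair.1).getD []))
    (n.unpair.2.unpair.2, n.unpair.2.unpair.1, [])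

theorem primrec_chk : Primrec₂ chk := by
  refine primrec_ev.comp (primrec_inst.comp
    (Primrec.pair (primrec_bnd.comp snd) fst)
    (option_getD.comp (Primrec.decode.comp (primrec_u1.comp snd)) (const [])))
    (Primrec.pair (primrec_u2.comp (primrec_u2.comp snd))
      (Primrec.pair (primrec_u1.comp (primrec_u2.comp snd)) (const [])))

/-- The decision procedure. -/
def solve (n : ℕ) : Bool :=
  decide (∃ m < (2 * bnd n + 1) ^ (n + 1), chk m n = true)

theorem primrec_solve : Primrec solve := by
  have h : PrimrecRel fun m n => chk m n = true := Primrec.eq.comp primrec_chk (const true)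
  exact PrimrecPred.decide (PrimrecRel.comp (PrimrecRel.exists_lt h)
    (primrec_pow.comp (succ.comp (nat_mul.comp (const 2) primrec_bnd)) succ) Primrec.id)

end PTL

/-! ### Part E: conclusion -/

namespace PTL

theorem encode_finset {α : Type} [Encodable α] [DecidableEq α] (s : Finset α) :
    ∃ l : List α, Encodable.encode s = Encodable.encode l ∧ l.toFinset = s := by
  obtain ⟨s, hs⟩ := s
  induction s using Quot.inductionOn with
  | h l =>
    refine ⟨_, rfl, ?_⟩
    ext a
    rw [List.mem_toFinset]
    exact List.mem_mergeSort

theorem encode_hist (h : ZPoHistory) : ∃ L : List (List (ℕ × List (ℕ ⊕ ℤ))),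
    Encodable.encode h = Encodable.encode L ∧ L.map List.toFinset = h := by
  induction h with
  | nil => exact ⟨[], rfl, rfl⟩
  | cons s h ih =>
    obtain ⟨L, h1, h2⟩ := ih
    obtain ⟨l, h3, h4⟩ := encode_finset s
    refine ⟨l :: L, ?_, by simp [h2, h4]⟩
    rw [Encodable.encode_list_cons, Encodable.encode_list_cons, h1, h3]

theorem inst_toFinset (τ : ℕ → ℤ) (L : List (List (ℕ × List (ℕ ⊕ ℤ)))) :
    (inst τ L).map List.toFinset = applySub τ (L.map List.toFinset) := by
  simp only [inst, applySub, List.map_map]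
  apply List.map_congr_left
  intro s _
  ext e
  simp

theorem usmall_of_encode (u : ℕ ⊕ ℤ) (N : ℕ) (h : Encodable.encode u < N) : USmall N u := by
  rcases u with v | c
  · have : Encodable.encode (Sum.inl v : ℕ ⊕ ℤ) = 2 * v := rfl
    rw [this] at h
    show v < N
    omega
  · have : Encodable.encode (Sum.inr c : ℕ ⊕ ℤ) = 2 * Encodable.encode c + 1 := rfl
    rw [this] at h
    have := natAbs_le_encode c
    show c.natAbs ≤ N
    omega

theorem usmall_hist (L : List (List (ℕ × List (ℕ ⊕ ℤ)))) (N : ℕ) (hN : Encodable.encode L ≤ N)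
    (k : ℕ) (e : ℕ × List (ℕ ⊕ ℤ)) (he : e ∈ (L.map List.toFinset).getD k ∅)
    (u : ℕ ⊕ ℤ) (hu : u ∈ e.2) : USmall N u := by
  apply usmall_of_encode
  by_cases hk : k < L.length
  · have h1 : (L.map List.toFinset).getD k ∅ = (L[k]).toFinset := by
      simp [List.getD, hk]
    rw [h1, List.mem_toFinset] at he
    have a1 := mem_encode_lt (List.getElem_mem hk)
    have a2 := mem_encode_lt he
    have a3 := mem_encode_lt hu
    have a4 : Encodable.encode e.2 ≤ Encodable.encode e := by
      obtain ⟨p, us⟩ := e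
      exact Nat.right_le_pair _ _
    omega
  · have h1 : (L.map List.toFinset).getD k ∅ = ∅ := by
      simp [List.getD, hk]
    rw [h1] at he
    simp at he

theorem digits (b : ℕ) (d : ℕ → ℕ) (k : ℕ) (hd : ∀ v < k, d v < b) :
    ∃ m < b ^ k, ∀ v < k, (m / b ^ v) % b = d v := by
  induction k generalizing d with
  | zero => exact ⟨0, by simp, by simp⟩
  | succ k ih =>
    obtain ⟨m, hm, h⟩ := ih (fun v => d (v + 1)) (fun v hv => hd (v + 1) (by omega))
    have h0 := hd 0 (by omega)
    refine ⟨d 0 + b * m, ?_, ?_⟩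
    · rw [pow_succ]
      have : b * (m + 1) ≤ b * b ^ k := Nat.mul_le_mul_left _ hm
      nlinarith
    · intro v hv
      cases v with
      | zero => simp [Nat.mod_eq_of_lt h0]
      | succ v =>
        have hb : 0 < b := by omega
        rw [pow_succ', ← Nat.div_div_eq_div_mul, Nat.add_mul_div_left _ _ hb,
          Nat.div_eq_of_lt h0, zero_add]
        exact h v (by omega)

theorem dig_exists (B : ℕ) (y : ℕ → ℤ) (k : ℕ) (hy : ∀ v < k, |y v| ≤ B) :
    ∃ m < (2 * B + 1) ^ k, ∀ v < k, dig B m v = y v := by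
  obtain ⟨m, hm, h⟩ := digits (2 * B + 1) (fun v => (y v + B).toNat) k (fun v hv => by
    have := abs_le.1 (hy v hv)
    omega)
  refine ⟨m, hm, fun v hv => ?_⟩
  have := abs_le.1 (hy v hv)
  rw [dig, h v hv]
  omega

theorem chk_iff (m : ℕ) (h : ZPoHistory) (i : ℕ) (ψ : LFm) :
    chk m (Nat.pair (Encodable.encode h) (Nat.pair i ψ.enc)) = true ↔
      LSat (applySub (dig (bnd (Nat.pair (Encodable.encode h) (Nat.pair i ψ.enc))) m) h) i
        (fun _ => 0) ψ := by
  obtain ⟨L, h1, h2⟩ := encode_hist h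
  have hl : look [] = fun _ => 0 := rfl
  rw [chk, Nat.unpair_pair, Nat.unpair_pair, ← hl, h1]
  dsimp only
  rw [Encodable.encodek, Option.getD_some, ev_correct, inst_toFinset, h2]

theorem solve_iff (h : ZPoHistory) (i : ℕ) (ψ : LFm) (hc : ψ.Closed) :
    solve (Nat.pair (Encodable.encode h) (Nat.pair i ψ.enc)) = true ↔ LPotSat h i ψ := by
  rw [solve, decide_eq_true_iff]
  constructor
  · rintro ⟨m, -, hm⟩
    rw [chk_iff] at hm
    refine ⟨_, fun ρ => (sat_congr _ ψ i _ _ ?_).1 hm⟩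
    intro v hv
    rw [hc] at hv
    simp at hv
  · rintro ⟨σ, hσ⟩
    simp only [chk_iff]
    set n := Nat.pair (Encodable.encode h) (Nat.pair i ψ.enc) with hn
    have e1 : Encodable.encode h ≤ n := Nat.left_le_pair _ _
    have e2 : ψ.enc ≤ n := (Nat.right_le_pair _ _).trans (Nat.right_le_pair _ _)
    obtain ⟨y, hr, hy⟩ := exists_small (n + 1) (2 * ((n + 1) * (n + 1) + (n + 1))) 1 one_pos σ
    obtain ⟨m, hm, hd⟩ := dig_exists (bnd n) y (n + 1) hy
    refine ⟨m, hm, ?_⟩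
    have hA : Agree (n + 1) σ (dig (bnd n) m) := by
      rintro f ⟨a, c, ha, hc', hf⟩
      rw [hf, hf, hr.1 a c (by exact_mod_cast ha) (by exact_mod_cast hc')]
      have : lin (n + 1) a c y = lin (n + 1) a c (dig (bnd n) m) := by
        unfold lin
        congr 1
        apply Finset.sum_congr rfl
        intro v hv
        rw [hd v (Finset.mem_range.1 hv)]
      rw [this]
    obtain ⟨L, h1, h2⟩ := encode_hist h
    have ht := sat_transfer hA h (fun k e he u hu => by
      rw [← h2] at he
      exact usmall_hist L (n + 1) (by omega) k e he u hu) ψ (by omega) i (fun _ => Sum.inr 0)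
      (fun v => by show (0 : ℤ).natAbs ≤ _; simp)
    exact ht.1 (hσ _)

end PTL

/-- The potential satisfiability problem for PTLTL^FO with linear
arithmetic is decidable: there is a computable function which, given (the natural
encodings of) a po-history `h`, an index `i` with `1 ≤ i ≤ |h|`, and a closed formula
`ψ`, returns `true` if `(h,i) ⊢ ψ` and `false` otherwise. -/
theorem lpotsat_decidable :
    ∃ f : ℕ → Bool, Computable f ∧
      ∀ (h : ZPoHistory) (i : ℕ) (ψ : LFm), 1 ≤ i → i ≤ h.length → ψ.Closed →
        (f (Nat.pair (Encodable.encode h) (Nat.pair i ψ.enc)) = true ↔ LPotSat h i ψ) := by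
  exact ⟨PTL.solve, PTL.primrec_solve.to_comp, fun h i ψ _ _ hc => PTL.solve_iff h i ψ hc⟩
end

section
/- The adherence problem for PTLTL^FO with linear arithmetic is decidable: there is a computable function which, given (under the natural encodings) a po-history h, an index i with 1 ≤ i ≤ |h|, and a closed formula ψ of PTLTL^FO with linear arithmetic, returns true if (h,i) ⊩ ψ and false otherwise. -/
/-! ### Part 1: bounded representatives for linear types -/

/-- The linear form with coefficients `a` in the first `n` variables. -/
def linS (n : ℕ) (a x : ℕ → ℤ) : ℤ := ∑ i ∈ Finset.range n, a i * x i

/-- Same linear type up to level `M` on the first `n` variables. -/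
def LEqv (n M : ℕ) (x y : ℕ → ℤ) : Prop :=
  (∀ (a : ℕ → ℤ) (b : ℤ), (∀ i < n, |a i| ≤ M) → |b| ≤ M → (linS n a x ≤ b ↔ linS n a y ≤ b)) ∧
    ∀ i < n, (M.factorial : ℤ) ∣ x i - y i

def nextM (M : ℕ) : ℕ := 2 * (M * M.factorial + 1) + M.factorial * M.factorial + 1

theorem linS_sub (n : ℕ) (a b x : ℕ → ℤ) :
    linS n (fun i => a i - b i) x = linS n a x - linS n b x := by
  simp [linS, sub_mul, Finset.sum_sub_distrib]

theorem linS_smul (n : ℕ) (m : ℤ) (a x : ℕ → ℤ) :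
    linS n (fun i => m * a i) x = m * linS n a x := by
  simp [linS, Finset.mul_sum, mul_assoc]

theorem linS_update (n : ℕ) (a x : ℕ → ℤ) (v : ℤ) :
    linS (n + 1) a (Function.update x n v) = linS n a x + a n * v := by
  unfold linS
  rw [Finset.sum_range_succ]
  congr 1
  · apply Finset.sum_congr rfl
    intro i hi
    have : i ≠ n := by have := Finset.mem_range.1 hi; omega
    rw [Function.update_of_ne this]
  · simp

theorem linS_bound (n : ℕ) (a y : ℕ → ℤ) (K b : ℤ) (hK : 0 ≤ K) (ha : ∀ i < n, |a i| ≤ K)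
    (hy : ∀ i < n, |y i| ≤ b) : |linS n a y| ≤ n * (K * b) := by
  unfold linS
  refine (Finset.abs_sum_le_sum_abs _ _).trans ?_
  have : ∀ i ∈ Finset.range n, |a i * y i| ≤ K * b := by
    intro i hi
    have hi := Finset.mem_range.1 hi
    rw [abs_mul]
    exact mul_le_mul (ha i hi) (hy i hi) (abs_nonneg _) hK
  refine (Finset.sum_le_sum this).trans ?_
  simp

theorem exists_rem (r E : ℤ) (hE : 0 < E) :
    ∃ r', E ∣ r' - r ∧ |r'| ≤ E ∧ (0 < r → 0 < r' ∧ r' ≤ r) ∧ (r ≤ 0 → r ≤ r' ∧ r' ≤ 0) := by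
  by_cases h : 0 < r
  · refine ⟨(r - 1) % E + 1, ?_, ?_, ?_, ?_⟩
    · have := Int.emod_add_mul_ediv (r - 1) E
      exact ⟨-((r - 1) / E), by linarith⟩
    · have h1 := Int.emod_nonneg (r - 1) hE.ne'
      have h2 := Int.emod_lt_of_pos (r - 1) hE
      rw [abs_le]; omega
    · intro _
      have h1 := Int.emod_nonneg (r - 1) hE.ne'
      have h2 := Int.emod_add_mul_ediv (r - 1) E
      have h3 : 0 ≤ (r - 1) / E := Int.ediv_nonneg (by omega) hE.le
      have : 0 ≤ E * ((r - 1) / E) := mul_nonneg hE.le h3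
      constructor <;> linarith
    · omega
  · refine ⟨-((-r) % E), ?_, ?_, ?_, ?_⟩
    · have := Int.emod_add_mul_ediv (-r) E
      exact ⟨((-r) / E), by linarith⟩
    · have h1 := Int.emod_nonneg (-r) hE.ne'
      have h2 := Int.emod_lt_of_pos (-r) hE
      rw [abs_le]; omega
    · omega
    · intro _
      have h1 := Int.emod_nonneg (-r) hE.ne'
      have h2 := Int.emod_add_mul_ediv (-r) E
      have h3 : 0 ≤ (-r) / E := Int.ediv_nonneg (by omega) hE.le
      have : 0 ≤ E * ((-r) / E) := mul_nonneg hE.le h3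
      constructor <;> linarith

theorem LEqv_key (n M : ℕ) (x y : ℕ → ℤ) (h : LEqv n (nextM M) x y) (w b' : ℤ)
    (hy : ∀ i < n, |y i| ≤ b') :
    ∃ w' : ℤ, ((M.factorial * M.factorial : ℕ) : ℤ) ∣ w' - w ∧
      |w'| ≤ nextM M * (1 + n * b') ∧
      ∀ (a : ℕ → ℤ) (b : ℤ), (∀ i < n, |a i| ≤ (M * M.factorial + 1 : ℕ)) →
        |b| ≤ (M * M.factorial + 1 : ℕ) → (w ≤ b - linS n a x ↔ w' ≤ b - linS n a y) := by
  obtain ⟨h1, h2⟩ := h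
  have hM' : nextM M = 2 * (M * M.factorial + 1) + M.factorial * M.factorial + 1 := rfl
  generalize hK : M * M.factorial + 1 = K at *
  have hEpos : 0 < M.factorial * M.factorial := Nat.mul_pos M.factorial_pos M.factorial_pos
  generalize hE : M.factorial * M.factorial = E at *
  have hdvd : (E : ℤ) ∣ ((nextM M).factorial : ℤ) := by
    exact_mod_cast Nat.dvd_factorial hEpos (by omega)
  -- nearest threshold
  let P : ℕ → Prop := fun d => ∃ (a : ℕ → ℤ) (b : ℤ), (∀ i < n, |a i| ≤ K) ∧ |b| ≤ K ∧
    d = (w - (b - linS n a x)).natAbs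
  have hP : ∃ d, P d := ⟨_, fun _ => 0, 0, by simp, by simp, rfl⟩
  classical
  obtain ⟨a0, b0, ha0, hb0, hd0⟩ := Nat.find_spec hP
  have hmin : ∀ (a : ℕ → ℤ) (b : ℤ), (∀ i < n, |a i| ≤ K) → |b| ≤ K →
      (w - (b0 - linS n a0 x)).natAbs ≤ (w - (b - linS n a x)).natAbs := by
    intro a b ha hb
    rw [← hd0]
    exact Nat.find_min' hP ⟨a, b, ha, hb, rfl⟩
  obtain ⟨r', hr1, hr2, hr3, hr4⟩ := exists_rem (w - (b0 - linS n a0 x)) E (by exact_mod_cast hEpos)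
  refine ⟨b0 - linS n a0 y + r', ?_, ?_, ?_⟩
  · have hs : (E : ℤ) ∣ linS n a0 x - linS n a0 y := by
      unfold linS
      rw [← Finset.sum_sub_distrib]
      apply Finset.dvd_sum
      intro i hi
      rw [← mul_sub]
      exact Dvd.dvd.mul_left (hdvd.trans (h2 i (Finset.mem_range.1 hi))) _
    have e : b0 - linS n a0 y + r' - w =
        linS n a0 x - linS n a0 y + (r' - (w - (b0 - linS n a0 x))) := by ring
    rw [e]
    exact dvd_add hs hr1
  · have hb := linS_bound n a0 y K b' (by positivity) ha0 hy
    have : |b0 - linS n a0 y + r'| ≤ |b0| + |linS n a0 y| + |r'| :=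
      (abs_add_le _ _).trans (by gcongr; exact abs_sub _ _)
    have hM2 : ((nextM M : ℕ) : ℤ) = 2 * K + E + 1 := by rw [hM']; push_cast; ring
    rw [hM2]
    have hn : (0:ℤ) ≤ n * b' := by
      rcases Nat.eq_zero_or_pos n with hn | hn
      · simp [hn]
      · exact mul_nonneg (by positivity) ((abs_nonneg _).trans (hy 0 hn))
    have hKn : (0:ℤ) ≤ K := by positivity
    have hEn : (0:ℤ) ≤ E := by positivity
    nlinarith
  · intro a b ha hb
    have hm := hmin a b ha hb
    have H : ∀ k : ℤ, |k| ≤ E + 1 → (k ≤ (b - linS n a x) - (b0 - linS n a0 x) ↔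
        k ≤ (b - linS n a y) - (b0 - linS n a0 y)) := by
      intro k hk
      have := h1 (fun i => a i - a0 i) (b - b0 - k) (by
        intro i hi
        have e1 := ha i hi
        have e2 := ha0 i hi
        rw [hM']
        rw [abs_le] at *
        push_cast
        omega) (by
        rw [hM']
        rw [abs_le] at *
        push_cast
        omega)
      rw [linS_sub, linS_sub] at this
      constructor
      · intro h; have := this.1 (by linarith); linarith
      · intro h; have := this.2 (by linarith); linarith
    have H0 := H 0 (by simp; omega)
    have Hr := H r' (by omega)
    generalize linS n a x = A at *
    generalize linS n a y = B at *
    generalize linS n a0 x = A0 at *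
    generalize linS n a0 y = B0 at *
    clear hdvd h1 h2 hr1 H hP hmin hd0
    omega

theorem LEqv_step (n M : ℕ) (x y : ℕ → ℤ) (h : LEqv n (nextM M) x y) (u b' : ℤ)
    (hy : ∀ i < n, |y i| ≤ b') :
    ∃ v : ℤ, |v| ≤ nextM M * (1 + n * b') ∧
      LEqv (n + 1) M (Function.update x n u) (Function.update y n v) := by
  obtain ⟨w', hw1, hw2, hw3⟩ := LEqv_key n M x y h (M.factorial * u) b' hy
  have hLpos : (0:ℤ) < M.factorial := by exact_mod_cast M.factorial_pos
  obtain ⟨q, hq⟩ := hw1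
  push_cast at hq
  obtain ⟨v, hv⟩ : ∃ v, v = u + M.factorial * q := ⟨_, rfl⟩
  have hwv : w' = M.factorial * v := by rw [hv]; linarith
  have hMM : (M : ℤ) ≤ nextM M := by
    unfold nextM
    have := M.factorial_pos
    have : M ≤ M * M.factorial := Nat.le_mul_of_pos_right M this
    exact_mod_cast (by omega)
  refine ⟨v, ?_, ?_, ?_⟩
  · refine le_trans ?_ hw2
    rw [hwv, abs_mul, abs_of_pos hLpos]
    have : 0 ≤ |v| := abs_nonneg v
    nlinarith
  · intro a b ha hb
    rw [linS_update, linS_update]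
    have hc := ha n (by omega)
    have ha' : ∀ i < n, |a i| ≤ M := fun i hi => ha i (by omega)
    -- a generic bound
    have key : ∀ m : ℤ, 0 < m → m ≤ M.factorial → ∀ s : ℤ, |s| ≤ M → |m * s| ≤ (M * M.factorial : ℕ) := by
      intro m hm hm2 s hs
      rw [abs_mul, abs_of_pos hm]
      push_cast
      rw [mul_comm (M : ℤ)]
      exact mul_le_mul hm2 hs (abs_nonneg _) hLpos.le
    rcases lt_trichotomy (a n) 0 with hneg | hz | hpos
    · obtain ⟨m, hm⟩ : -a n ∣ (M.factorial : ℤ) := by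
        rw [abs_of_neg hneg] at hc
        have h1 : (-a n).natAbs ∣ M.factorial := Nat.dvd_factorial (by omega) (by omega)
        exact Int.natAbs_dvd.1 (by exact_mod_cast h1)
      have hm0 : 0 < m := by
        by_contra hcon
        have : -a n * m ≤ 0 := mul_nonpos_of_nonneg_of_nonpos (by omega) (by omega)
        omega
      have hmL : m ≤ M.factorial := by rw [hm]; nlinarith
      have := hw3 (fun i => (-m) * a i) (-(m * b) - 1) (by
        intro i hi
        have := key m hm0 hmL _ (ha' i hi)
        show |(-m) * a i| ≤ _
        rw [neg_mul, abs_neg]; push_cast at this ⊢; linarith) (by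
        have := key m hm0 hmL _ hb
        rw [abs_le] at this ⊢
        push_cast at this ⊢
        constructor <;> linarith)
      rw [linS_smul, linS_smul, hwv] at this
      have e1 : ∀ s z : ℤ, s + a n * z ≤ b ↔ ¬ ((M.factorial : ℤ) * z ≤ -(m * b) - 1 - -m * s) := by
        intro s z
        rw [hm, not_le]
        constructor
        · intro h
          have := mul_le_mul_of_nonneg_left h hm0.le
          nlinarith
        · intro h
          by_contra hcon
          push Not at hcon
          have := mul_le_mul_of_nonneg_left (Int.add_one_le_of_lt hcon) hm0.le
          nlinarith
      rw [e1, e1, this]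
    · rw [hz, zero_mul, zero_mul, add_zero, add_zero]
      exact h.1 a b (fun i hi => (ha' i hi).trans hMM) (hb.trans hMM)
    · obtain ⟨m, hm⟩ : a n ∣ (M.factorial : ℤ) := by
        rw [abs_of_pos hpos] at hc
        have h1 : (a n).natAbs ∣ M.factorial := Nat.dvd_factorial (by omega) (by omega)
        exact Int.natAbs_dvd.1 (by exact_mod_cast h1)
      have hm0 : 0 < m := by
        by_contra hcon
        have : a n * m ≤ 0 := mul_nonpos_of_nonneg_of_nonpos (by omega) (by omega)
        omega
      have hmL : m ≤ M.factorial := by rw [hm]; nlinarith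
      have := hw3 (fun i => m * a i) (m * b) (by
        intro i hi
        have := key m hm0 hmL _ (ha' i hi)
        show |m * a i| ≤ _
        push_cast at this ⊢; linarith) (by
        have := key m hm0 hmL _ hb
        push_cast at this ⊢; linarith)
      rw [linS_smul, linS_smul, hwv] at this
      have e1 : ∀ s z : ℤ, s + a n * z ≤ b ↔ ((M.factorial : ℤ) * z ≤ m * b - m * s) := by
        intro s z
        rw [hm]
        constructor
        · intro h
          have := mul_le_mul_of_nonneg_left h hm0.le
          nlinarith
        · intro h
          have : m * (s + a n * z) ≤ m * b := by nlinarith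
          exact le_of_mul_le_mul_left this hm0
      rw [e1, e1, this]
  · intro i hi
    by_cases hin : i = n
    · subst hin
      simp only [Function.update_self]
      exact ⟨-q, by rw [hv]; ring⟩
    · rw [Function.update_of_ne hin, Function.update_of_ne hin]
      have : ((M.factorial : ℕ) : ℤ) ∣ ((nextM M).factorial : ℤ) := by
        exact_mod_cast Nat.factorial_dvd_factorial (by exact_mod_cast hMM)
      exact this.trans (h.2 i (by omega))

/-- The bound: `T` dominates all levels, iterate `j` times. -/
def bdIt (T n : ℕ) : ℕ → ℕ
  | 0 => 0
  | j + 1 => bdIt T n j + T * (1 + n * bdIt T n j)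

theorem le_nextM (M : ℕ) : M ≤ nextM M := by
  unfold nextM
  have := Nat.le_mul_of_pos_right M M.factorial_pos
  omega

theorem exists_LEqv (T N : ℕ) (x : ℕ → ℤ) : ∀ (n M : ℕ), n ≤ N → nextM^[n] M ≤ T →
    ∃ y : ℕ → ℤ, (∀ i < n, |y i| ≤ bdIt T N n) ∧ LEqv n M x y := by
  intro n
  induction n with
  | zero =>
    intro M _ _
    exact ⟨fun _ => 0, by simp, by simp [LEqv, linS]⟩
  | succ n ih =>
    intro M hN hT
    rw [Function.iterate_succ_apply] at hT
    obtain ⟨y, hy, he⟩ := ih (nextM M) (by omega) hT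
    obtain ⟨v, hv, hev⟩ := LEqv_step n M x y he (x n) _ hy
    rw [Function.update_eq_self] at hev
    refine ⟨_, ?_, hev⟩
    have hle : nextM M ≤ T := by
      refine le_trans ?_ hT
      have : id ≤ nextM := le_nextM
      exact Function.id_le_iterate_of_id_le this n (nextM M)
    have h1 : nextM M * (1 + n * bdIt T N n) ≤ T * (1 + N * bdIt T N n) := by
      gcongr
      omega
    intro i hi
    by_cases hin : i = n
    · subst hin
      rw [Function.update_self]
      refine hv.trans ?_
      rw [bdIt]
      exact_mod_cast (by omega)
    · rw [Function.update_of_ne hin]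
      refine (hy i (by omega)).trans ?_
      rw [bdIt]
      push_cast
      have : (0:ℤ) ≤ T * (1 + N * bdIt T N n) := by positivity
      linarith


/-! ### Part 2: invariance of satisfaction -/

def valU (σ : ℕ → ℤ) (u : ℕ ⊕ ℤ) : ℤ := Sum.elim σ id u

def GoodU (N : ℕ) (u : ℕ ⊕ ℤ) : Prop := Encodable.encode u ≤ N

theorem natAbs_le_encode (k : ℤ) : k.natAbs ≤ Encodable.encode k := by
  cases k with
  | ofNat n => 
    show n ≤ 2 * n
    omega
  | negSucc n =>
    show n + 1 ≤ 2 * n + 1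
    omega

theorem abs_le_encode (k : ℤ) : |k| ≤ (Encodable.encode k : ℕ) := by
  have := natAbs_le_encode k
  rw [Int.abs_eq_natAbs]
  exact_mod_cast this

theorem encode_mem_le {α : Type*} [Encodable α] {a : α} {l : List α} (h : a ∈ l) :
    Encodable.encode a ≤ Encodable.encode l := by
  induction l with
  | nil => simp at h
  | cons b l ih =>
    rw [Encodable.encode_list_cons]
    have h1 := Nat.add_le_pair (Encodable.encode b) (Encodable.encode l)
    rcases List.mem_cons.1 h with rfl | h
    · omega
    · have := ih h
      omega

def IsLin (n A : ℕ) (f : (ℕ → ℤ) → ℤ) : Prop :=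
  ∃ (a : ℕ → ℤ) (c : ℤ), (∀ i < n, |a i| ≤ A) ∧ |c| ≤ A ∧ ∀ σ, f σ = linS n a σ + c

theorem IsLin.mono {n A B : ℕ} {f} (h : IsLin n A f) (hAB : A ≤ B) : IsLin n B f := by
  obtain ⟨a, c, ha, hc, hf⟩ := h
  have : (A : ℤ) ≤ B := by exact_mod_cast hAB
  exact ⟨a, c, fun i hi => (ha i hi).trans this, hc.trans this, hf⟩

theorem IsLin.const {n A : ℕ} (c : ℤ) (h : |c| ≤ A) : IsLin n A (fun _ => c) :=
  ⟨fun _ => 0, c, by simp, h, by simp [linS]⟩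

theorem IsLin.add {n A B : ℕ} {f g} (hf : IsLin n A f) (hg : IsLin n B g) :
    IsLin n (A + B) (fun σ => f σ + g σ) := by
  obtain ⟨a, c, ha, hc, hf⟩ := hf
  obtain ⟨a', c', ha', hc', hg⟩ := hg
  refine ⟨fun i => a i + a' i, c + c', ?_, ?_, ?_⟩
  · intro i hi
    push_cast
    exact (abs_add_le _ _).trans (add_le_add (ha i hi) (ha' i hi))
  · push_cast
    exact (abs_add_le _ _).trans (add_le_add hc hc')
  · intro σ
    dsimp only
    rw [hf, hg]
    simp only [linS, add_mul, Finset.sum_add_distrib]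
    ring

theorem IsLin.smul {n A : ℕ} {f} (k : ℤ) (hf : IsLin n A f) :
    IsLin n (k.natAbs * A) (fun σ => k * f σ) := by
  obtain ⟨a, c, ha, hc, hf⟩ := hf
  have hk : ((k.natAbs : ℕ) : ℤ) = |k| := by simp
  refine ⟨fun i => k * a i, k * c, ?_, ?_, ?_⟩
  · intro i hi
    push_cast
    rw [abs_mul]
    exact mul_le_mul_of_nonneg_left (ha i hi) (abs_nonneg _)
  · push_cast
    rw [abs_mul]
    exact mul_le_mul_of_nonneg_left hc (abs_nonneg _)
  · intro σ
    dsimp only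
    rw [hf, linS_smul]
    ring

theorem IsLin.valU {N : ℕ} {u} (hu : GoodU N u) : IsLin (N + 1) (N + 1) (fun σ => valU σ u) := by
  cases u with
  | inl x =>
    have hx : 2 * x ≤ N := hu
    refine ⟨fun i => if i = x then 1 else 0, 0, ?_, by simp; omega, ?_⟩
    · intro i _
      dsimp only
      split_ifs <;> simp <;> omega
    · intro σ
      simp [linS, _root_.valU]
      intro h
      omega
  | inr c =>
    have hx : 2 * Encodable.encode c + 1 ≤ N := hu
    have := abs_le_encode c
    exact IsLin.const c (by push_cast; omega)

theorem IsLin.coeffs {N : ℕ} {θ : ℕ → ℕ ⊕ ℤ} (hθ : ∀ v, GoodU N (θ v)) (l : List (ℤ × ℕ)) :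
    IsLin (N + 1) (Encodable.encode l * (N + 1))
      (fun σ => (l.map fun q => q.1 * _root_.valU σ (θ q.2)).sum) := by
  induction l with
  | nil => exact IsLin.const 0 (by simp)
  | cons q l ih =>
    have h1 := ((IsLin.valU (hθ q.2)).smul q.1).add ih
    simp only [List.map_cons, List.sum_cons]
    refine h1.mono ?_
    rw [Encodable.encode_list_cons, ← Nat.add_mul]
    have h1 := Nat.add_le_pair (Encodable.encode q) (Encodable.encode l)
    have h2 : Encodable.encode q = Nat.pair (Encodable.encode q.1) (Encodable.encode q.2) := rfl
    have h3 := Nat.left_le_pair (Encodable.encode q.1) (Encodable.encode q.2)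
    have h4 := natAbs_le_encode q.1
    apply Nat.mul_le_mul_right
    omega

theorem IsLin.eval {N : ℕ} {θ : ℕ → ℕ ⊕ ℤ} (hθ : ∀ v, GoodU N (θ v)) (t : LTm) (ht : t.enc ≤ N) :
    IsLin (N + 1) ((N + 1) * (N + 1)) (fun σ => t.eval (fun v => _root_.valU σ (θ v))) := by
  have h1 := (IsLin.coeffs hθ t.coeffs).add (IsLin.const (n := N + 1) t.const (abs_le_encode t.const))
  refine h1.mono ?_
  have h2 := Nat.add_le_pair (Encodable.encode t.coeffs) (Encodable.encode t.const)
  have h3 : t.enc = Nat.pair (Encodable.encode t.coeffs) (Encodable.encode t.const) := rfl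
  have h4 : Encodable.encode t.const ≤ Encodable.encode t.const * (N + 1) :=
    Nat.le_mul_of_pos_right _ (by omega)
  calc _ ≤ (Encodable.encode t.coeffs + Encodable.encode t.const) * (N + 1) := by
        rw [Nat.add_mul]; omega
    _ ≤ _ := Nat.mul_le_mul_right _ (by omega)

def lev (N : ℕ) : ℕ := 2 * ((N + 1) * (N + 1))

theorem IsLin.le_iff {N : ℕ} {σ σ' : ℕ → ℤ} (he : LEqv (N + 1) (lev N) σ σ') {f g}
    (hf : IsLin (N + 1) ((N + 1) * (N + 1)) f) (hg : IsLin (N + 1) ((N + 1) * (N + 1)) g) :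
    f σ ≤ g σ ↔ f σ' ≤ g σ' := by
  obtain ⟨a, c, ha, hc, hf⟩ := hf
  obtain ⟨a', c', ha', hc', hg⟩ := hg
  have hl : ((lev N : ℕ) : ℤ) = 2 * ((((N + 1) * (N + 1) : ℕ)) : ℤ) := by unfold lev; push_cast; ring
  have := he.1 (fun i => a i - a' i) (c' - c) (by
    intro i hi
    have h1 := ha i hi
    have h2 := ha' i hi
    rw [hl]
    rw [abs_le] at *
    constructor <;> linarith) (by
    rw [hl]
    rw [abs_le] at *
    constructor <;> linarith)
  rw [linS_sub, linS_sub] at this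
  rw [hf, hf, hg, hg]
  constructor
  · intro h; have := this.1 (by linarith); linarith
  · intro h; have := this.2 (by linarith); linarith

theorem IsLin.eq_iff {N : ℕ} {σ σ' : ℕ → ℤ} (he : LEqv (N + 1) (lev N) σ σ') {f g}
    (hf : IsLin (N + 1) ((N + 1) * (N + 1)) f) (hg : IsLin (N + 1) ((N + 1) * (N + 1)) g) :
    f σ = g σ ↔ f σ' = g σ' := by
  rw [le_antisymm_iff, le_antisymm_iff, IsLin.le_iff he hf hg, IsLin.le_iff he hg hf]

theorem mem_applySub (σ : ℕ → ℤ) (h : ZPoHistory) (k : ℕ) (p : ℕ) (cs : List ℤ) :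
    (p, cs) ∈ (applySub σ h).getD k ∅ ↔ ∃ e ∈ h.getD k ∅, e.1 = p ∧ e.2.map (valU σ) = cs := by
  unfold applySub
  rw [List.getD_eq_getElem?_getD, List.getD_eq_getElem?_getD, List.getElem?_map]
  cases h[k]? with
  | none => simp
  | some s =>
    simp only [Option.map_some, Option.getD_some, Finset.mem_image, Prod.mk.injEq]
    rfl

def updU (θ : ℕ → ℕ ⊕ ℤ) (xs : List ℕ) (us : List (ℕ ⊕ ℤ)) : ℕ → ℕ ⊕ ℤ :=
  fun v => ((xs.zip us).lookup v).getD (θ v)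

theorem lookup_zip_map (f : (ℕ ⊕ ℤ) → ℤ) (v : ℕ) : ∀ (xs : List ℕ) (us : List (ℕ ⊕ ℤ)),
    (xs.zip (us.map f)).lookup v = ((xs.zip us).lookup v).map f := by
  intro xs
  induction xs with
  | nil => simp
  | cons x xs ih =>
    intro us
    cases us with
    | nil => simp
    | cons u us =>
      simp only [List.map_cons, List.zip_cons_cons, List.lookup_cons]
      split
      · simp
      · exact ih us

theorem updEnv_valU (σ θ) (xs : List ℕ) (us : List (ℕ ⊕ ℤ)) :
    updEnv (fun v => valU σ (θ v)) xs (us.map (valU σ)) = fun v => valU σ (updU θ xs us v) := by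
  funext v
  unfold updEnv updU
  rw [lookup_zip_map]
  cases (xs.zip us).lookup v <;> simp

theorem lookup_zip_mem (v : ℕ) (u) : ∀ (xs : List ℕ) (us : List (ℕ ⊕ ℤ)),
    (xs.zip us).lookup v = some u → u ∈ us := by
  intro xs
  induction xs with
  | nil => simp
  | cons x xs ih =>
    intro us
    cases us with
    | nil => simp
    | cons u us =>
      simp only [List.zip_cons_cons, List.lookup_cons]
      split
      · intro h; simp at h; simp [h]
      · intro h
        exact List.mem_cons_of_mem _ (ih us h)

theorem updU_good {N : ℕ} {θ} (hθ : ∀ v, GoodU N (θ v)) (xs : List ℕ) (us : List (ℕ ⊕ ℤ))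
    (hus : ∀ u ∈ us, GoodU N u) : ∀ v, GoodU N (updU θ xs us v) := by
  intro v
  unfold updU
  cases h : (xs.zip us).lookup v with
  | none => exact hθ v
  | some u => exact hus u (lookup_zip_mem v u xs us h)

theorem map_eq_map_iff_sim {α β γ : Type*} (f f' : α → γ) (g g' : β → γ) :
    ∀ (l : List α) (l' : List β), (∀ a ∈ l, ∀ b ∈ l', (f a = g b ↔ f' a = g' b)) →
      (l.map f = l'.map g ↔ l.map f' = l'.map g') := by
  intro l
  induction l with
  | nil => intro l' _; cases l' <;> simp
  | cons a l ih =>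
    intro l' h
    cases l' with
    | nil => simp
    | cons b l' =>
      simp only [List.map_cons, List.cons.injEq]
      rw [h a (by simp) b (by simp), ih l' (fun a ha b hb => h a (by simp [ha]) b (by simp [hb]))]

theorem LSat_sim {N : ℕ} {σ σ' : ℕ → ℤ} (he : LEqv (N + 1) (lev N) σ σ') (h : ZPoHistory)
    (hh : ∀ s ∈ h, ∀ e ∈ s, ∀ u ∈ e.2, GoodU N u) (ψ : LFm) : ψ.enc ≤ N → ∀ (i : ℕ) (θ : ℕ → ℕ ⊕ ℤ),
    (∀ v, GoodU N (θ v)) →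
    (LSat (applySub σ h) i (fun v => valU σ (θ v)) ψ ↔
      LSat (applySub σ' h) i (fun v => valU σ' (θ v)) ψ) := by
  have hh' : ∀ k, ∀ e ∈ h.getD k ∅, ∀ u ∈ e.2, GoodU N u := by
    intro k e hek
    rw [List.getD_eq_getElem?_getD] at hek
    cases hs : h[k]? with
    | none => simp [hs] at hek
    | some s =>
      simp [hs] at hek
      exact hh s (List.mem_of_getElem? hs) e hek
  have p2 : ∀ k a b, Nat.pair k (Nat.pair a b) ≤ N → a ≤ N ∧ b ≤ N := by
    intro k a b h
    have h1 := Nat.add_le_pair k (Nat.pair a b)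
    have h2 := Nat.add_le_pair a b
    omega
  have p1 : ∀ k a, Nat.pair k a ≤ N → a ≤ N := by
    intro k a h
    have h1 := Nat.add_le_pair k a
    omega
  induction ψ with
  | atom p ts =>
    intro hN i θ hθ
    simp only [LSat]
    rw [mem_applySub, mem_applySub]
    apply exists_congr
    intro e
    apply and_congr_right
    intro hes
    apply and_congr_right
    intro _
    apply map_eq_map_iff_sim
    intro u hu t ht
    have htN : t.enc ≤ N := by
      have h1 : Encodable.encode (ts.map LTm.enc) ≤ N := (p2 _ _ _ hN).2
      have h2 : Encodable.encode t.enc ≤ _ := encode_mem_le (List.mem_map_of_mem (f := LTm.enc) ht)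
      exact h2.trans h1
    refine IsLin.eq_iff he (f := fun σ => valU σ u) (g := fun σ => t.eval (fun v => valU σ (θ v))) ?_ ?_
    · exact (IsLin.valU (hh' _ e hes u hu)).mono (Nat.le_mul_of_pos_right _ (by omega))
    · exact IsLin.eval hθ t htN
  | eq s t =>
    intro hN i θ hθ
    simp only [LSat]
    exact IsLin.eq_iff he (IsLin.eval hθ s (p2 _ _ _ hN).1) (IsLin.eval hθ t (p2 _ _ _ hN).2)
  | le s t =>
    intro hN i θ hθ
    simp only [LSat]
    exact IsLin.le_iff he (IsLin.eval hθ s (p2 _ _ _ hN).1) (IsLin.eval hθ t (p2 _ _ _ hN).2)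
  | ge s t =>
    intro hN i θ hθ
    simp only [LSat]
    exact IsLin.le_iff he (IsLin.eval hθ t (p2 _ _ _ hN).2) (IsLin.eval hθ s (p2 _ _ _ hN).1)
  | and a b iha ihb =>
    intro hN i θ hθ
    simp only [LSat]
    rw [iha (p2 _ _ _ hN).1 i θ hθ, ihb (p2 _ _ _ hN).2 i θ hθ]
  | not a iha =>
    intro hN i θ hθ
    simp only [LSat]
    rw [iha (p1 _ _ hN) i θ hθ]
  | prev a iha =>
    intro hN i θ hθ
    simp only [LSat]
    rw [iha (p1 _ _ hN) (i - 1) θ hθ]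
  | since a b iha ihb =>
    intro hN i θ hθ
    simp only [LSat]
    have ha := fun k => iha (p2 _ _ _ hN).1 k θ hθ
    have hb := fun k => ihb (p2 _ _ _ hN).2 k θ hθ
    simp only [ha, hb]
  | all xs p a iha =>
    intro hN i θ hθ
    have key : ∀ σ : ℕ → ℤ, LSat (applySub σ h) i (fun v => valU σ (θ v)) (.all xs p a) ↔
        ∀ e ∈ h.getD (i - 1) ∅, e.1 = p → e.2.length = xs.length →
          LSat (applySub σ h) i (fun v => valU σ (updU θ xs e.2 v)) a := by
      intro σ
      simp only [LSat, mem_applySub]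
      constructor
      · intro H e he1 he2 he3
        have := H (e.2.map (valU σ)) (by simpa using he3) ⟨e, he1, he2, rfl⟩
        rwa [updEnv_valU] at this
      · rintro H cs hcs ⟨e, he1, he2, rfl⟩
        rw [updEnv_valU]
        exact H e he1 he2 (by simpa using hcs)
    rw [key, key]
    have haN : a.enc ≤ N := p1 _ _ (p2 _ _ _ hN).2
    apply forall_congr'
    intro e
    apply forall_congr'
    intro hes
    apply forall_congr'
    intro _
    apply forall_congr'
    intro _
    exact iha haN i _ (updU_good hθ xs e.2 (hh' _ e hes))

theorem LSat_congr (h : List ZSession) (ψ : LFm) : ∀ (i : ℕ) (ρ ρ' : ℕ → ℤ),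
    (∀ v ∈ ψ.fv, ρ v = ρ' v) → (LSat h i ρ ψ ↔ LSat h i ρ' ψ) := by
  have hev : ∀ (t : LTm) (ρ ρ' : ℕ → ℤ), (∀ v ∈ t.vars, ρ v = ρ' v) → t.eval ρ = t.eval ρ' := by
    intro t ρ ρ' hv
    unfold LTm.eval
    congr 2
    apply List.map_congr_left
    intro q hq
    rw [hv q.2 (List.mem_map_of_mem hq)]
  induction ψ with
  | atom p ts =>
    intro i ρ ρ' hv
    simp only [LSat]
    have : ts.map (LTm.eval ρ) = ts.map (LTm.eval ρ') := by
      apply List.map_congr_left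
      intro t ht
      apply hev
      intro v hvt
      exact hv v (List.mem_flatMap.2 ⟨t, ht, hvt⟩)
    rw [this]
  | eq s t =>
    intro i ρ ρ' hv
    simp only [LFm.fv, List.mem_append] at hv
    simp only [LSat]
    rw [hev s ρ ρ' (fun v h => hv v (.inl h)), hev t ρ ρ' (fun v h => hv v (.inr h))]
  | le s t =>
    intro i ρ ρ' hv
    simp only [LFm.fv, List.mem_append] at hv
    simp only [LSat]
    rw [hev s ρ ρ' (fun v h => hv v (.inl h)), hev t ρ ρ' (fun v h => hv v (.inr h))]
  | ge s t =>
    intro i ρ ρ' hv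
    simp only [LFm.fv, List.mem_append] at hv
    simp only [LSat]
    rw [hev s ρ ρ' (fun v h => hv v (.inl h)), hev t ρ ρ' (fun v h => hv v (.inr h))]
  | and a b iha ihb =>
    intro i ρ ρ' hv
    simp only [LFm.fv, List.mem_append] at hv
    simp only [LSat]
    rw [iha i ρ ρ' (fun v h => hv v (.inl h)), ihb i ρ ρ' (fun v h => hv v (.inr h))]
  | not a iha =>
    intro i ρ ρ' hv
    simp only [LSat]
    rw [iha i ρ ρ' hv]
  | prev a iha =>
    intro i ρ ρ' hv
    simp only [LSat]
    rw [iha (i - 1) ρ ρ' hv]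
  | since a b iha ihb =>
    intro i ρ ρ' hv
    simp only [LFm.fv, List.mem_append] at hv
    simp only [LSat]
    have ha := fun k => iha k ρ ρ' (fun v h => hv v (.inl h))
    have hb := fun k => ihb k ρ ρ' (fun v h => hv v (.inr h))
    simp only [ha, hb]
  | all xs p a iha =>
    intro i ρ ρ' hv
    simp only [LSat]
    apply forall_congr'
    intro cs
    apply forall_congr'
    intro hcs
    apply forall_congr'
    intro _
    apply iha
    intro v hva
    unfold updEnv
    by_cases hvx : v ∈ xs
    · have : ((xs.zip cs).lookup v).isSome := by
        have aux : ∀ (xs : List ℕ) (cs : List ℤ), cs.length = xs.length → v ∈ xs →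
            ((xs.zip cs).lookup v).isSome := by
          intro xs
          induction xs with
          | nil => simp
          | cons x xs ih =>
            intro cs hl hm
            cases cs with
            | nil => simp at hl
            | cons c cs =>
              simp only [List.zip_cons_cons, List.lookup_cons]
              split
              · simp
              · rename_i hne
                apply ih cs (by simpa using hl)
                rcases List.mem_cons.1 hm with rfl | hm
                · simp at hne
                · exact hm
        exact aux xs cs hcs hvx
      obtain ⟨c, hc⟩ := Option.isSome_iff_exists.1 this
      simp [hc]
    · rw [hv v (by simp [LFm.fv, hva, hvx])]


/-! ### Part 3: the evaluator -/

abbrev EHist := List (List (ℕ × List ℤ))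
abbrev EEnv := List (ℕ × ℤ)
abbrev ETask := EEnv × ℕ × ℕ

def eLk (ρ : EEnv) (v : ℕ) : ℤ := (ρ.lookup v).getD 0

def eTm (ρ : EEnv) (c : ℕ) : ℤ :=
  ((Encodable.decode (α := List (ℤ × ℕ)) c.unpair.1).getD []).foldr
    (fun q s => q.1 * eLk ρ q.2 + s) 0 + (Encodable.decode (α := ℤ) c.unpair.2).getD 0

def eArg (e : ℕ) : ℕ := e.unpair.2
def eA1 (e : ℕ) : ℕ := e.unpair.2.unpair.1
def eA2 (e : ℕ) : ℕ := e.unpair.2.unpair.2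
def eSess (h : EHist) (i : ℕ) : List (ℕ × List ℤ) := h.getD (i - 1) []
def eNats (c : ℕ) : List ℕ := (Encodable.decode (α := List ℕ) c).getD []
def eExt (xs : List ℕ) (cs : List ℤ) (ρ : EEnv) : EEnv :=
  (List.range xs.length).map (fun k => (xs.getD k 0, cs.getD k 0)) ++ ρ

def eAllChild (t : ETask) (ev : ℕ × List ℤ) : List ETask :=
  if ev.1 = (eA2 t.2.2).unpair.1 ∧ ev.2.length = (eNats (eA1 t.2.2)).length then
    [(eExt (eNats (eA1 t.2.2)) ev.2 t.1, t.2.1, (eA2 t.2.2).unpair.2)] else []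

def eChildren (h : EHist) (t : ETask) : List ETask :=
  if t.2.2.unpair.1 = 4 then [(t.1, t.2.1, eA1 t.2.2), (t.1, t.2.1, eA2 t.2.2)]
  else if t.2.2.unpair.1 = 5 then [(t.1, t.2.1, eArg t.2.2)]
  else if t.2.2.unpair.1 = 6 then [(t.1, t.2.1 - 1, eArg t.2.2)]
  else if t.2.2.unpair.1 = 7 then
    (if t.2.1 = 0 then [] else
      [(t.1, t.2.1, eA2 t.2.2), (t.1, t.2.1, eA1 t.2.2), (t.1, t.2.1 - 1, t.2.2)])
  else if t.2.2.unpair.1 = 8 then (eSess h t.2.1).flatMap (eAllChild t)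
  else []

def eAtom (h : EHist) (t : ETask) : Bool :=
  decide ((eA1 t.2.2, (eNats (eA2 t.2.2)).map (eTm t.1)) ∈ eSess h t.2.1)

def eComb (h : EHist) (t : ETask) (l : List Bool) : Bool :=
  if t.2.2.unpair.1 = 0 then eAtom h t
  else if t.2.2.unpair.1 = 1 then decide (eTm t.1 (eA1 t.2.2) = eTm t.1 (eA2 t.2.2))
  else if t.2.2.unpair.1 = 2 then decide (eTm t.1 (eA1 t.2.2) ≤ eTm t.1 (eA2 t.2.2))
  else if t.2.2.unpair.1 = 3 then decide (eTm t.1 (eA2 t.2.2) ≤ eTm t.1 (eA1 t.2.2))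
  else if t.2.2.unpair.1 = 4 then l.getD 0 false && l.getD 1 false
  else if t.2.2.unpair.1 = 5 then !(l.getD 0 false)
  else if t.2.2.unpair.1 = 6 then decide (1 < t.2.1) && l.getD 0 false
  else if t.2.2.unpair.1 = 7 then l.getD 0 false || (l.getD 1 false && l.getD 2 false)
  else l.foldr and true

def eMeas (t : ETask) : ℕ := t.2.2 + t.2.1

theorem eChildren_lt (h : EHist) (t t' : ETask) (ht : t' ∈ eChildren h t) : eMeas t' < eMeas t := by
  obtain ⟨ρ, i, e⟩ := t
  have h1 := Nat.add_le_pair e.unpair.1 e.unpair.2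
  rw [Nat.pair_unpair] at h1
  have h2 := Nat.add_le_pair (eA1 e) (eA2 e)
  have h2' : Nat.pair (eA1 e) (eA2 e) = eArg e := Nat.pair_unpair _
  rw [h2'] at h2
  have h3 := Nat.unpair_right_le (eA2 e)
  have h4 : eArg e = e.unpair.2 := rfl
  unfold eChildren at ht
  dsimp only at ht
  split_ifs at ht
  · simp only [List.mem_cons, List.not_mem_nil, or_false] at ht
    rcases ht with rfl | rfl <;> simp only [eMeas] <;> omega
  · simp only [List.mem_cons, List.not_mem_nil, or_false] at ht
    subst ht; simp only [eMeas]; omega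
  · simp only [List.mem_cons, List.not_mem_nil, or_false] at ht
    subst ht; simp only [eMeas]; omega
  · simp at ht
  · simp only [List.mem_cons, List.not_mem_nil, or_false] at ht
    rcases ht with rfl | rfl | rfl <;> simp only [eMeas] <;> omega
  · obtain ⟨ev, _, hev⟩ := List.mem_flatMap.1 ht
    unfold eAllChild at hev
    split_ifs at hev
    · simp only [List.mem_cons, List.not_mem_nil, or_false] at hev
      subst hev; simp only [eMeas]; omega
    · simp at hev
  · simp at ht

def eF (h : EHist) (t : ETask) : Bool :=
  eComb h t ((eChildren h t).attach.map fun t' => eF h t'.1)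
termination_by eMeas t
decreasing_by exact eChildren_lt h t _ t'.2

theorem eF_eq (h : EHist) (t : ETask) : eF h t = eComb h t ((eChildren h t).map (eF h)) := by
  rw [eF]
  congr 1
  simp only [List.map_attach_eq_pmap, List.pmap_eq_map]

theorem eTm_enc (ρ : EEnv) (t : LTm) : eTm ρ t.enc = t.eval (eLk ρ) := by
  unfold eTm LTm.enc LTm.eval
  rw [Nat.unpair_pair]
  simp only [Encodable.encodek, Option.getD_some]
  congr 1
  induction t.coeffs with
  | nil => rfl
  | cons q l ih => simp [ih]

theorem eExt_lk (xs : List ℕ) (cs : List ℤ) (ρ : EEnv) (h : cs.length = xs.length) :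
    eLk (eExt xs cs ρ) = updEnv (eLk ρ) xs cs := by
  have hz : (List.range xs.length).map (fun k => (xs.getD k 0, cs.getD k 0)) = xs.zip cs := by
    apply List.ext_getElem
    · simp [h]
    · intro k h1 h2
      simp at h1
      simp [h, h1]
  funext v
  unfold eLk updEnv eExt
  rw [hz, List.lookup_append]
  cases (xs.zip cs).lookup v <;> simp

theorem eSess_mem (h : EHist) (i : ℕ) (ev : ℕ × List ℤ) :
    ev ∈ (h.map List.toFinset).getD (i - 1) ∅ ↔ ev ∈ eSess h i := by
  unfold eSess
  rw [List.getD_eq_getElem?_getD, List.getD_eq_getElem?_getD, List.getElem?_map]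
  cases h[i - 1]? <;> simp

theorem foldr_and_iff (l : List Bool) : l.foldr and true = true ↔ ∀ b ∈ l, b = true := by
  induction l with
  | nil => simp
  | cons b l ih => simp [ih]

theorem since_succ (h : List ZSession) (ρ) (a b : LFm) (i : ℕ) (hi : i ≠ 0) :
    LSat h i ρ (.since a b) ↔ LSat h i ρ b ∨ (LSat h i ρ a ∧ LSat h (i - 1) ρ (.since a b)) := by
  simp only [LSat]
  constructor
  · rintro ⟨j, h1, h2, h3, h4⟩
    by_cases hj : j = i
    · subst hj; exact .inl h3
    · exact .inr ⟨h4 i (by omega) le_rfl, j, h1, by omega, h3, fun k hk1 hk2 => h4 k hk1 (by omega)⟩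
  · rintro (hb | ⟨ha, j, h1, h2, h3, h4⟩)
    · exact ⟨i, by omega, le_rfl, hb, fun k _ _ => by omega⟩
    · refine ⟨j, h1, by omega, h3, fun k hk1 hk2 => ?_⟩
      by_cases hk : k = i
      · subst hk; exact ha
      · exact h4 k hk1 (by omega)

theorem eF_correct (h : EHist) (ψ : LFm) : ∀ (i : ℕ) (ρ : EEnv),
    eF h (ρ, i, ψ.enc) = true ↔ LSat (h.map List.toFinset) i (eLk ρ) ψ := by
  induction ψ with
  | atom p ts =>
    intro i ρ
    rw [eF_eq]
    simp only [LSat, eSess_mem]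
    simp [eComb, LFm.enc, eAtom, eA1, eA2, eNats, Function.comp_def, eTm_enc]
  | eq s t =>
    intro i ρ
    rw [eF_eq]
    simp [LSat, eComb, LFm.enc, eA1, eA2, eTm_enc]
  | le s t =>
    intro i ρ
    rw [eF_eq]
    simp [LSat, eComb, LFm.enc, eA1, eA2, eTm_enc]
  | ge s t =>
    intro i ρ
    rw [eF_eq]
    simp [LSat, eComb, LFm.enc, eA1, eA2, eTm_enc]
  | and a b iha ihb =>
    intro i ρ
    rw [eF_eq]
    simp [LSat, eComb, LFm.enc, eA1, eA2, eChildren, iha, ihb]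
  | not a iha =>
    intro i ρ
    rw [eF_eq]
    simp [LSat, eComb, LFm.enc, eArg, eChildren, ← iha]
  | prev a iha =>
    intro i ρ
    rw [eF_eq]
    simp [LSat, eComb, LFm.enc, eArg, eChildren, iha]
  | since a b iha ihb =>
    intro i ρ
    induction i with
    | zero =>
      rw [eF_eq]
      simp [eComb, LFm.enc, eChildren, LSat]
    | succ i ih =>
      rw [since_succ _ _ _ _ _ (by omega)]
      rw [Nat.add_sub_cancel, ← ih, ← iha, ← ihb, eF_eq]
      simp [eComb, LFm.enc, eChildren, eA1, eA2]
  | all xs p a iha =>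
    intro i ρ
    rw [eF_eq]
    simp only [LSat, eSess_mem]
    have : eComb h (ρ, i, (LFm.all xs p a).enc)
        ((eChildren h (ρ, i, (LFm.all xs p a).enc)).map (eF h)) =
        ((eChildren h (ρ, i, (LFm.all xs p a).enc)).map (eF h)).foldr and true := by
      have h8 : (LFm.all xs p a).enc.unpair.1 = 8 := by simp [LFm.enc]
      generalize (LFm.all xs p a).enc = e at *
      simp [eComb, h8]
    rw [this, foldr_and_iff]
    have hc : eChildren h (ρ, i, (LFm.all xs p a).enc) =
        (eSess h i).flatMap (fun ev => if ev.1 = p ∧ ev.2.length = xs.length then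
          [(eExt xs ev.2 ρ, i, a.enc)] else []) := by
      have h8 : (LFm.all xs p a).enc.unpair.1 = 8 := by simp [LFm.enc]
      have hA1 : eNats (eA1 (LFm.all xs p a).enc) = xs := by simp [LFm.enc, eA1, eNats]
      have hA2 : eA2 (LFm.all xs p a).enc = Nat.pair p a.enc := by simp [LFm.enc, eA2]
      generalize (LFm.all xs p a).enc = e at *
      unfold eChildren
      simp only [h8]
      rw [if_neg (by decide), if_neg (by decide), if_neg (by decide), if_neg (by decide),
        if_pos trivial]
      congr 1
      funext ev
      simp only [eAllChild, hA1, hA2, Nat.unpair_pair]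
    rw [hc]
    constructor
    · intro H cs hcs hm
      rw [← eExt_lk xs cs ρ hcs, ← iha]
      apply H
      apply List.mem_map_of_mem
      rw [List.mem_flatMap]
      exact ⟨_, hm, by simp [hcs]⟩
    · intro H b hb
      obtain ⟨t, ht, rfl⟩ := List.mem_map.1 hb
      obtain ⟨ev, hev, ht⟩ := List.mem_flatMap.1 ht
      split_ifs at ht with hcond
      · simp only [List.mem_cons, List.not_mem_nil, or_false] at ht
        subst ht
        rw [iha, eExt_lk _ _ _ hcond.2]
        apply H _ hcond.2
        rw [← hcond.1]
        exact hev
      · simp at ht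

abbrev PHist := List (List (ℕ × List (ℕ ⊕ ℤ)))

def eVal (σ : List ℤ) (u : ℕ ⊕ ℤ) : ℤ := Sum.casesOn u (fun x => σ.getD x 0) id

def eSub (σ : List ℤ) (h : PHist) : EHist :=
  h.map fun s => s.map fun e => (e.1, e.2.map (eVal σ))

theorem eSub_eq (σ : List ℤ) (h : PHist) :
    (eSub σ h).map List.toFinset = applySub (fun x => σ.getD x 0) (h.map List.toFinset) := by
  unfold eSub applySub
  rw [List.map_map, List.map_map]
  apply List.map_congr_left
  intro s _
  ext ev
  simp only [Function.comp, List.mem_toFinset, List.mem_map, Finset.mem_image]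
  have : ∀ u, eVal σ u = Sum.elim (fun x => σ.getD x 0) id u := by
    intro u; cases u <;> rfl
  have : eVal σ = Sum.elim (fun x => σ.getD x 0) id := funext this
  rw [this]

theorem exists_list_encode (s : ZPoSession) :
    ∃ l : List (ℕ × List (ℕ ⊕ ℤ)), Encodable.encode l = Encodable.encode s ∧ l.toFinset = s := by
  have h : Encodable.encode s = encodeMultiset s.val := rfl
  unfold encodeMultiset at h
  refine ⟨_, h.symm, ?_⟩
  ext x
  simp

theorem exists_hist_encode (h : ZPoHistory) :
    ∃ l : PHist, Encodable.encode l = Encodable.encode h ∧ l.map List.toFinset = h := by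
  induction h with
  | nil => exact ⟨[], rfl, rfl⟩
  | cons s h ih =>
    obtain ⟨l, h1, h2⟩ := ih
    obtain ⟨l', h3, h4⟩ := exists_list_encode s
    refine ⟨l' :: l, ?_, by simp [h2, h4]⟩
    rw [Encodable.encode_list_cons, Encodable.encode_list_cons, h1, h3]

def eBox (B : ℕ) (k : ℕ) : List (List ℤ) :=
  Nat.rec [[]] (fun _ L => L.flatMap fun l =>
    (List.range (2 * B + 1)).map fun j => Int.subNatNat j B :: l) k

theorem mem_eBox (B : ℕ) : ∀ (l : List ℤ), (∀ z ∈ l, |z| ≤ B) → l ∈ eBox B l.length := by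
  intro l
  induction l with
  | nil => intro _; simp [eBox]
  | cons z l ih =>
    intro hz
    have h1 := ih (fun z hz' => hz z (by simp [hz']))
    have h2 := hz z (by simp)
    show _ ∈ (eBox B l.length).flatMap _
    rw [List.mem_flatMap]
    refine ⟨l, h1, ?_⟩
    rw [List.mem_map]
    rw [abs_le] at h2
    refine ⟨(z + B).toNat, ?_, ?_⟩
    · rw [List.mem_range]; omega
    · rw [Int.subNatNat_eq_coe]
      congr 1
      omega

def eBound (N : ℕ) : ℕ := bdIt (nextM^[N + 1] (lev N)) (N + 1) (N + 1)

def eMain (N : ℕ) : Bool :=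
  ((eBox (eBound N) (N + 1)).map fun σ =>
    eF (eSub σ ((Encodable.decode (α := PHist) N.unpair.1).getD []))
      ([], N.unpair.2.unpair.1, N.unpair.2.unpair.2)).foldr and true

theorem LEqv_congr {n M : ℕ} {x y z : ℕ → ℤ} (h : LEqv n M x y) (hyz : ∀ i < n, y i = z i) :
    LEqv n M x z := by
  have : ∀ a, linS n a y = linS n a z := by
    intro a
    apply Finset.sum_congr rfl
    intro i hi
    rw [hyz i (Finset.mem_range.1 hi)]
  refine ⟨fun a b ha hb => ?_, fun i hi => ?_⟩
  · rw [← this]; exact h.1 a b ha hb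
  · rw [← hyz i hi]; exact h.2 i hi

theorem eMain_correct (h : ZPoHistory) (i : ℕ) (ψ : LFm) (hψ : ψ.Closed) :
    eMain (Nat.pair (Encodable.encode h) (Nat.pair i ψ.enc)) = true ↔ LAdheres h i ψ := by
  obtain ⟨hl, hl1, hl2⟩ := exists_hist_encode h
  generalize hN : Nat.pair (Encodable.encode h) (Nat.pair i ψ.enc) = N
  have hhN : Encodable.encode hl ≤ N := by
    rw [hl1, ← hN]; exact Nat.left_le_pair _ _
  have hψN : ψ.enc ≤ N := by
    rw [← hN]; exact (Nat.right_le_pair _ _).trans (Nat.right_le_pair _ _)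
  have hm : eMain N = true ↔ ∀ σ ∈ eBox (eBound N) (N + 1),
      LSat (applySub (fun x => σ.getD x 0) h) i (eLk []) ψ := by
    unfold eMain
    rw [foldr_and_iff, ← hN]
    simp only [Nat.unpair_pair, ← hl1, Encodable.encodek, Option.getD_some, List.mem_map]
    constructor
    · intro H σ hσ
      rw [← hl2, ← eSub_eq, ← eF_correct]
      exact H _ ⟨σ, hσ, rfl⟩
    · rintro H b ⟨σ, hσ, rfl⟩
      rw [eF_correct, eSub_eq, hl2]
      exact H σ hσ
  rw [hm]
  constructor
  · intro H σ ρ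
    obtain ⟨y, hy, he⟩ := exists_LEqv (nextM^[N + 1] (lev N)) (N + 1) σ (N + 1) (lev N) le_rfl le_rfl
    have hlen : ((List.range (N + 1)).map y).length = N + 1 := by simp
    have hmem := mem_eBox (eBound N) ((List.range (N + 1)).map y) (by
      intro z hz
      obtain ⟨k, hk, rfl⟩ := List.mem_map.1 hz
      exact hy k (List.mem_range.1 hk))
    rw [hlen] at hmem
    have H1 := H _ hmem
    have he' : LEqv (N + 1) (lev N) σ (fun x => ((List.range (N + 1)).map y).getD x 0) := by
      apply LEqv_congr he
      intro k hk
      simp [List.getD_eq_getElem?_getD, hk]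
    have hsim := LSat_sim he' h (by
      intro s hs e hes u hu
      rw [← hl2] at hs
      obtain ⟨s', hs', rfl⟩ := List.mem_map.1 hs
      rw [List.mem_toFinset] at hes
      have h1 := encode_mem_le hs'
      have h2 := encode_mem_le hes
      have h3 := encode_mem_le hu
      have h4 : Encodable.encode e.2 ≤ Encodable.encode e := Nat.right_le_pair _ _
      unfold GoodU
      omega) ψ hψN i (fun _ => Sum.inl 0) (fun _ => Nat.zero_le _)
    have hcl : ∀ v ∈ ψ.fv, False := by
      intro v hv
      rw [hψ] at hv
      simp at hv
    rw [LSat_congr _ ψ i ρ _ (fun v hv => (hcl v hv).elim), hsim,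
      LSat_congr _ ψ i _ (eLk []) (fun v hv => (hcl v hv).elim)]
    exact H1
  · intro H σ _
    exact H _ _


/-! ### Part 4: primitive recursiveness of the decision procedure -/


theorem enc_int_ofNat (n : ℕ) : Encodable.encode (n : ℤ) = 2 * n := rfl
theorem enc_int_negSucc (n : ℕ) : Encodable.encode (Int.negSucc n) = 2 * n + 1 := rfl

def posP (z : ℤ) : ℕ := z.toNat
def negP (z : ℤ) : ℕ := (-z).toNat

theorem posP_primrec : Primrec posP := by
  have h : Primrec fun z : ℤ =>
      if Encodable.encode z % 2 = 0 then Encodable.encode z / 2 else 0 :=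
    Primrec.ite (Primrec.eq.comp (Primrec.nat_mod.comp Primrec.encode (Primrec.const 2))
      (Primrec.const 0)) (Primrec.nat_div.comp Primrec.encode (Primrec.const 2)) (Primrec.const 0)
  refine h.of_eq fun z => ?_
  cases z with
  | ofNat n => 
    have := enc_int_ofNat n
    simp only [Int.ofNat_eq_natCast, posP, this]
    simp
  | negSucc n =>
    have := enc_int_negSucc n
    simp only [posP, this]
    simp [Nat.add_mod]

theorem negP_primrec : Primrec negP := by
  have h : Primrec fun z : ℤ =>
      if Encodable.encode z % 2 = 0 then 0 else Encodable.encode z / 2 + 1 :=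
    Primrec.ite (Primrec.eq.comp (Primrec.nat_mod.comp Primrec.encode (Primrec.const 2))
      (Primrec.const 0)) (Primrec.const 0)
      (Primrec.succ.comp (Primrec.nat_div.comp Primrec.encode (Primrec.const 2)))
  refine h.of_eq fun z => ?_
  cases z with
  | ofNat n => 
    have := enc_int_ofNat n
    simp only [Int.ofNat_eq_natCast, negP, this]
    simp
  | negSucc n =>
    have := enc_int_negSucc n
    simp only [negP, this]
    rw [if_neg (by omega)]
    omega

theorem subNatNat_primrec : Primrec₂ Int.subNatNat := by
  rw [← Primrec₂.encode_iff]
  have h : Primrec₂ fun p q : ℕ => if q ≤ p then 2 * (p - q) else 2 * (q - p - 1) + 1 :=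
    Primrec.ite (Primrec.nat_le.comp Primrec.snd Primrec.fst)
      (Primrec.nat_double.comp (Primrec.nat_sub.comp Primrec.fst Primrec.snd))
      (Primrec.nat_double_succ.comp (Primrec.nat_sub.comp
        (Primrec.nat_sub.comp Primrec.snd Primrec.fst) (Primrec.const 1)))
  refine h.of_eq fun p q => ?_
  split_ifs with hle
  · rw [Int.subNatNat_of_le hle]; rfl
  · rw [Int.subNatNat_of_lt (by omega)]; rfl

theorem int_parts (z : ℤ) : z = (posP z : ℤ) - (negP z : ℤ) := by
  unfold posP negP; omega

theorem int_add_primrec : Primrec₂ fun a b : ℤ => a + b := by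
  have h : Primrec₂ fun a b : ℤ => Int.subNatNat (posP a + posP b) (negP a + negP b) :=
    subNatNat_primrec.comp
      (Primrec.nat_add.comp (posP_primrec.comp Primrec.fst) (posP_primrec.comp Primrec.snd))
      (Primrec.nat_add.comp (negP_primrec.comp Primrec.fst) (negP_primrec.comp Primrec.snd))
  refine h.of_eq fun a b => ?_
  rw [Int.subNatNat_eq_coe]
  have h1 := int_parts a
  have h2 := int_parts b
  push_cast
  omega

theorem int_mul_primrec : Primrec₂ fun a b : ℤ => a * b := by
  have h : Primrec₂ fun a b : ℤ =>
      Int.subNatNat (posP a * posP b + negP a * negP b) (posP a * negP b + negP a * posP b) :=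
    subNatNat_primrec.comp
      (Primrec.nat_add.comp
        (Primrec.nat_mul.comp (posP_primrec.comp Primrec.fst) (posP_primrec.comp Primrec.snd))
        (Primrec.nat_mul.comp (negP_primrec.comp Primrec.fst) (negP_primrec.comp Primrec.snd)))
      (Primrec.nat_add.comp
        (Primrec.nat_mul.comp (posP_primrec.comp Primrec.fst) (negP_primrec.comp Primrec.snd))
        (Primrec.nat_mul.comp (negP_primrec.comp Primrec.fst) (posP_primrec.comp Primrec.snd)))
  refine h.of_eq fun a b => ?_
  rw [Int.subNatNat_eq_coe]
  conv_rhs => rw [int_parts a, int_parts b]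
  push_cast
  ring

theorem int_le_primrec : PrimrecRel fun a b : ℤ => a ≤ b := by
  have h : PrimrecRel fun a b : ℤ => posP a + negP b ≤ posP b + negP a :=
    Primrec.nat_le.comp
      (Primrec.nat_add.comp (posP_primrec.comp Primrec.fst) (negP_primrec.comp Primrec.snd))
      (Primrec.nat_add.comp (posP_primrec.comp Primrec.snd) (negP_primrec.comp Primrec.fst))
  refine h.of_eq fun a b => ?_
  have h1 := int_parts a
  have h2 := int_parts b
  omega

theorem eLk_primrec : Primrec₂ eLk :=
  Primrec.option_getD.comp (Primrec.listLookup.comp Primrec.snd Primrec.fst) (Primrec.const 0)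

theorem eTm_primrec : Primrec₂ eTm := by
  have hl : Primrec fun p : EEnv × ℕ =>
      (Encodable.decode (α := List (ℤ × ℕ)) p.2.unpair.1).getD [] :=
    Primrec.option_getD.comp
      (Primrec.decode.comp (Primrec.fst.comp (Primrec.unpair.comp Primrec.snd))) (Primrec.const [])
  have hc : Primrec fun p : EEnv × ℕ => (Encodable.decode (α := ℤ) p.2.unpair.2).getD 0 :=
    Primrec.option_getD.comp
      (Primrec.decode.comp (Primrec.snd.comp (Primrec.unpair.comp Primrec.snd))) (Primrec.const 0)
  have hs : Primrec₂ fun (p : EEnv × ℕ) (r : (ℤ × ℕ) × ℤ) => r.1.1 * eLk p.1 r.1.2 + r.2 :=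
    int_add_primrec.comp
      (int_mul_primrec.comp (Primrec.fst.comp (Primrec.fst.comp Primrec.snd))
        (eLk_primrec.comp (Primrec.fst.comp Primrec.fst)
          (Primrec.snd.comp (Primrec.fst.comp Primrec.snd))))
      (Primrec.snd.comp Primrec.snd)
  exact int_add_primrec.comp (Primrec.list_foldr hl (Primrec.const 0) hs) hc

theorem eArg_primrec : Primrec eArg := Primrec.snd.comp Primrec.unpair
theorem eA1_primrec : Primrec eA1 :=
  Primrec.fst.comp (Primrec.unpair.comp (Primrec.snd.comp Primrec.unpair))
theorem eA2_primrec : Primrec eA2 :=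
  Primrec.snd.comp (Primrec.unpair.comp (Primrec.snd.comp Primrec.unpair))
theorem eSess_primrec : Primrec₂ eSess :=
  (Primrec.list_getD []).comp Primrec.fst (Primrec.nat_sub.comp Primrec.snd (Primrec.const 1))
theorem eNats_primrec : Primrec eNats :=
  Primrec.option_getD.comp Primrec.decode (Primrec.const [])

theorem eExt_primrec :
    Primrec fun p : (List ℕ × List ℤ) × EEnv => eExt p.1.1 p.1.2 p.2 := by
  have hm : Primrec₂ fun (p : (List ℕ × List ℤ) × EEnv) (k : ℕ) =>
      (p.1.1.getD k 0, p.1.2.getD k 0) :=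
    Primrec.pair
      ((Primrec.list_getD 0).comp (Primrec.fst.comp (Primrec.fst.comp Primrec.fst)) Primrec.snd)
      ((Primrec.list_getD 0).comp (Primrec.snd.comp (Primrec.fst.comp Primrec.fst)) Primrec.snd)
  exact Primrec.list_append.comp
    (Primrec.list_map (Primrec.list_range.comp
      (Primrec.list_length.comp (Primrec.fst.comp Primrec.fst))) hm) Primrec.snd

theorem singleton_primrec {α β : Type*} [Primcodable α] [Primcodable β] {f : α → β}
    (hf : Primrec f) : Primrec fun a => [f a] :=
  Primrec.list_cons.comp hf (Primrec.const [])

theorem eAllChild_primrec : Primrec₂ eAllChild := by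
  have ht : Primrec fun p : ETask × (ℕ × List ℤ) => p.1 := Primrec.fst
  have he : Primrec fun p : ETask × (ℕ × List ℤ) => p.1.2.2 :=
    Primrec.snd.comp (Primrec.snd.comp ht)
  have hxs : Primrec fun p : ETask × (ℕ × List ℤ) => eNats (eA1 p.1.2.2) :=
    eNats_primrec.comp (eA1_primrec.comp he)
  have hu : Primrec fun p : ETask × (ℕ × List ℤ) => (eA2 p.1.2.2).unpair :=
    Primrec.unpair.comp (eA2_primrec.comp he)
  have hcs : Primrec fun p : ETask × (ℕ × List ℤ) => p.2.2 := Primrec.snd.comp Primrec.snd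
  exact Primrec.ite
    (PrimrecPred.and
      (Primrec.eq.comp (Primrec.fst.comp Primrec.snd) (Primrec.fst.comp hu))
      (Primrec.eq.comp (Primrec.list_length.comp hcs) (Primrec.list_length.comp hxs)))
    (singleton_primrec (Primrec.pair
      (eExt_primrec.comp (Primrec.pair (Primrec.pair hxs hcs) (Primrec.fst.comp ht)))
      (Primrec.pair (Primrec.fst.comp (Primrec.snd.comp ht)) (Primrec.snd.comp hu))))
    (Primrec.const [])

theorem eChildren_primrec : Primrec₂ eChildren := by
  have ht : Primrec fun p : EHist × ETask => p.2 := Primrec.snd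
  have hr : Primrec fun p : EHist × ETask => p.2.1 := Primrec.fst.comp ht
  have hi : Primrec fun p : EHist × ETask => p.2.2.1 := Primrec.fst.comp (Primrec.snd.comp ht)
  have hi1 : Primrec fun p : EHist × ETask => p.2.2.1 - 1 :=
    Primrec.nat_sub.comp hi (Primrec.const 1)
  have he : Primrec fun p : EHist × ETask => p.2.2.2 := Primrec.snd.comp (Primrec.snd.comp ht)
  have h1 := eA1_primrec.comp he
  have h2 := eA2_primrec.comp he
  have h0 := eArg_primrec.comp he
  have htag : ∀ k : ℕ, PrimrecPred fun p : EHist × ETask => p.2.2.2.unpair.1 = k := fun k =>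
    Primrec.eq.comp (Primrec.fst.comp (Primrec.unpair.comp he)) (Primrec.const k)
  refine Primrec.ite (htag 4)
    (Primrec.list_cons.comp (hr.pair (hi.pair h1)) (singleton_primrec (hr.pair (hi.pair h2)))) ?_
  refine Primrec.ite (htag 5) (singleton_primrec (hr.pair (hi.pair h0))) ?_
  refine Primrec.ite (htag 6) (singleton_primrec (hr.pair (hi1.pair h0))) ?_
  refine Primrec.ite (htag 7) ?_ ?_
  · refine Primrec.ite (Primrec.eq.comp hi (Primrec.const 0)) (Primrec.const []) ?_
    exact Primrec.list_cons.comp (hr.pair (hi.pair h2))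
      (Primrec.list_cons.comp (hr.pair (hi.pair h1)) (singleton_primrec (hr.pair (hi1.pair he))))
  refine Primrec.ite (htag 8) ?_ (Primrec.const [])
  exact Primrec.list_flatMap (eSess_primrec.comp Primrec.fst hi)
    (eAllChild_primrec.comp (ht.comp Primrec.fst) Primrec.snd)

theorem mem_list_primrec {α : Type*} [Primcodable α] :
    PrimrecRel fun (a : α) (l : List α) => a ∈ l := by
  have h : PrimrecRel fun (l : List α) (a : α) => ∃ b ∈ l, b = a :=
    PrimrecRel.exists_mem_list Primrec.eq
  refine h.swap.of_eq fun a l => ?_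
  simp [Function.swap]

theorem eAtom_primrec : Primrec₂ eAtom := by
  have ht : Primrec fun p : EHist × ETask => p.2 := Primrec.snd
  have hi : Primrec fun p : EHist × ETask => p.2.2.1 := Primrec.fst.comp (Primrec.snd.comp ht)
  have he : Primrec fun p : EHist × ETask => p.2.2.2 := Primrec.snd.comp (Primrec.snd.comp ht)
  have hargs : Primrec fun p : EHist × ETask => (eNats (eA2 p.2.2.2)).map (eTm p.2.1) :=
    Primrec.list_map (eNats_primrec.comp (eA2_primrec.comp he))
      (eTm_primrec.comp (Primrec.fst.comp (ht.comp Primrec.fst)) Primrec.snd)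
  exact (mem_list_primrec.comp ((eA1_primrec.comp he).pair hargs)
    (eSess_primrec.comp Primrec.fst hi)).decide

theorem allTrue_primrec : Primrec fun l : List Bool => l.foldr and true := by
  have h : Primrec₂ fun (_ : List Bool) (q : Bool × Bool) => and q.1 q.2 :=
    Primrec.and.comp (Primrec.fst.comp Primrec.snd) (Primrec.snd.comp Primrec.snd)
  exact Primrec.list_foldr Primrec.id (Primrec.const true) h

theorem eComb_primrec :
    Primrec fun p : EHist × (ETask × List Bool) => eComb p.1 p.2.1 p.2.2 := by
  have ht : Primrec fun p : EHist × (ETask × List Bool) => p.2.1 := Primrec.fst.comp Primrec.snd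
  have hl : Primrec fun p : EHist × (ETask × List Bool) => p.2.2 := Primrec.snd.comp Primrec.snd
  have hr : Primrec fun p : EHist × (ETask × List Bool) => p.2.1.1 := Primrec.fst.comp ht
  have hi : Primrec fun p : EHist × (ETask × List Bool) => p.2.1.2.1 :=
    Primrec.fst.comp (Primrec.snd.comp ht)
  have he : Primrec fun p : EHist × (ETask × List Bool) => p.2.1.2.2 :=
    Primrec.snd.comp (Primrec.snd.comp ht)
  have h1 := eTm_primrec.comp hr (eA1_primrec.comp he)
  have h2 := eTm_primrec.comp hr (eA2_primrec.comp he)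
  have hg : ∀ k : ℕ, Primrec fun p : EHist × (ETask × List Bool) => p.2.2.getD k false := fun k =>
    (Primrec.list_getD false).comp hl (Primrec.const k)
  have htag : ∀ k : ℕ, PrimrecPred fun p : EHist × (ETask × List Bool) =>
      p.2.1.2.2.unpair.1 = k := fun k =>
    Primrec.eq.comp (Primrec.fst.comp (Primrec.unpair.comp he)) (Primrec.const k)
  refine Primrec.ite (htag 0) (eAtom_primrec.comp Primrec.fst ht) ?_
  refine Primrec.ite (htag 1) (Primrec.eq.comp h1 h2).decide ?_
  refine Primrec.ite (htag 2) (int_le_primrec.comp h1 h2).decide ?_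
  refine Primrec.ite (htag 3) (int_le_primrec.comp h2 h1).decide ?_
  refine Primrec.ite (htag 4) (Primrec.and.comp (hg 0) (hg 1)) ?_
  refine Primrec.ite (htag 5) (Primrec.not.comp (hg 0)) ?_
  refine Primrec.ite (htag 6)
    (Primrec.and.comp (Primrec.nat_lt.comp (Primrec.const 1) hi).decide (hg 0)) ?_
  refine Primrec.ite (htag 7)
    (Primrec.or.comp (hg 0) (Primrec.and.comp (hg 1) (hg 2))) ?_
  exact allTrue_primrec.comp hl

theorem eF_primrec : Primrec₂ eF := by
  have hm : Primrec₂ fun (_ : EHist) (t : ETask) => eMeas t :=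
    Primrec.nat_add.comp (Primrec.snd.comp (Primrec.snd.comp Primrec.snd))
      (Primrec.fst.comp (Primrec.snd.comp Primrec.snd))
  have hg : Primrec₂ fun (h : EHist) (p : ETask × List Bool) => some (eComb h p.1 p.2) :=
    Primrec.option_some.comp eComb_primrec
  exact Primrec.nat_omega_rec eF hm eChildren_primrec hg (fun h t t' ht => eChildren_lt h t t' ht)
    (fun h t => congrArg some (eF_eq h t).symm)

theorem eVal_primrec : Primrec₂ eVal :=
  Primrec.sumCasesOn Primrec.snd
    ((Primrec.list_getD 0).comp (Primrec.fst.comp Primrec.fst) Primrec.snd) Primrec.snd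

theorem eSub_primrec : Primrec₂ eSub := by
  have h1 : Primrec₂ fun (σ : List ℤ) (e : ℕ × List (ℕ ⊕ ℤ)) => (e.1, e.2.map (eVal σ)) :=
    Primrec.pair (Primrec.fst.comp Primrec.snd)
      (Primrec.list_map (Primrec.snd.comp Primrec.snd)
        (eVal_primrec.comp (Primrec.fst.comp Primrec.fst) Primrec.snd))
  have h2 : Primrec₂ fun (σ : List ℤ) (s : List (ℕ × List (ℕ ⊕ ℤ))) =>
      s.map fun e => (e.1, e.2.map (eVal σ)) :=
    Primrec.list_map Primrec.snd (h1.comp (Primrec.fst.comp Primrec.fst) Primrec.snd)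
  exact Primrec.list_map Primrec.snd (h2.comp (Primrec.fst.comp Primrec.fst) Primrec.snd)

theorem eBox_primrec : Primrec₂ eBox := by
  have h1 : Primrec fun p : (ℕ × (ℕ × List (List ℤ))) × List ℤ =>
      (List.range (2 * p.1.1 + 1)).map fun j => Int.subNatNat j p.1.1 :: p.2 :=
    Primrec.list_map
      (Primrec.list_range.comp (Primrec.nat_double_succ.comp (Primrec.fst.comp Primrec.fst)))
      (Primrec.list_cons.comp
        (subNatNat_primrec.comp Primrec.snd (Primrec.fst.comp (Primrec.fst.comp Primrec.fst)))
        (Primrec.snd.comp Primrec.fst))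
  have h2 : Primrec₂ fun (B : ℕ) (q : ℕ × List (List ℤ)) =>
      q.2.flatMap fun l => (List.range (2 * B + 1)).map fun j => Int.subNatNat j B :: l :=
    Primrec.list_flatMap (Primrec.snd.comp Primrec.snd) h1
  exact Primrec.nat_rec (Primrec.const [[]]) h2

theorem factorial_primrec : Primrec Nat.factorial := by
  have h : Primrec₂ fun (n r : ℕ) => (n + 1) * r :=
    Primrec.nat_mul.comp (Primrec.succ.comp Primrec.fst) Primrec.snd
  refine (Primrec.nat_rec₁ 1 h).of_eq fun n => ?_
  induction n with
  | zero => rfl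
  | succ n ih => rw [Nat.factorial_succ, ← ih]

theorem nextM_primrec : Primrec nextM := by
  have hf := factorial_primrec
  exact Primrec.succ.comp (Primrec.nat_add.comp
    (Primrec.nat_double.comp (Primrec.succ.comp (Primrec.nat_mul.comp Primrec.id hf)))
    (Primrec.nat_mul.comp hf hf))

theorem lev_primrec : Primrec lev :=
  Primrec.nat_double.comp (Primrec.nat_mul.comp Primrec.succ Primrec.succ)

theorem bdIt_primrec : Primrec₂ fun (p : ℕ × ℕ) (j : ℕ) => bdIt p.1 p.2 j := by
  have h : Primrec₂ fun (p : ℕ × ℕ) (q : ℕ × ℕ) => q.2 + p.1 * (1 + p.2 * q.2) :=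
    Primrec.nat_add.comp (Primrec.snd.comp Primrec.snd)
      (Primrec.nat_mul.comp (Primrec.fst.comp Primrec.fst)
        (Primrec.nat_add.comp (Primrec.const 1)
          (Primrec.nat_mul.comp (Primrec.snd.comp Primrec.fst) (Primrec.snd.comp Primrec.snd))))
  refine (Primrec.nat_rec (Primrec.const 0) h).of_eq fun p j => ?_
  induction j with
  | zero => rfl
  | succ j ih => rw [bdIt, ← ih]

theorem eBound_primrec : Primrec eBound := by
  have hT : Primrec fun N : ℕ => nextM^[N + 1] (lev N) :=
    Primrec.nat_iterate Primrec.succ lev_primrec (nextM_primrec.comp Primrec.snd)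
  exact bdIt_primrec.comp (hT.pair Primrec.succ) Primrec.succ

theorem eMain_primrec : Primrec eMain := by
  have hh : Primrec fun N : ℕ => (Encodable.decode (α := PHist) N.unpair.1).getD [] :=
    Primrec.option_getD.comp (Primrec.decode.comp (Primrec.fst.comp Primrec.unpair))
      (Primrec.const [])
  have hb : Primrec fun N : ℕ => eBox (eBound N) (N + 1) :=
    eBox_primrec.comp eBound_primrec Primrec.succ
  have hu : Primrec fun N : ℕ => N.unpair.2.unpair :=
    Primrec.unpair.comp (Primrec.snd.comp Primrec.unpair)
  have ht : Primrec fun N : ℕ =>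
      (([], N.unpair.2.unpair.1, N.unpair.2.unpair.2) : ETask) :=
    Primrec.pair (Primrec.const []) ((Primrec.fst.comp hu).pair (Primrec.snd.comp hu))
  have hs : Primrec₂ fun (N : ℕ) (σ : List ℤ) =>
      eF (eSub σ ((Encodable.decode (α := PHist) N.unpair.1).getD []))
        ([], N.unpair.2.unpair.1, N.unpair.2.unpair.2) :=
    eF_primrec.comp (eSub_primrec.comp Primrec.snd (hh.comp Primrec.fst)) (ht.comp Primrec.fst)
  exact allTrue_primrec.comp (Primrec.list_map hb hs)

/-- The adherence problem for PTLTL^FO with linear arithmetic is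
decidable: there is a computable function which, given (the natural encodings of) a
po-history `h`, an index `i` with `1 ≤ i ≤ |h|`, and a closed formula `ψ`, returns
`true` if `(h,i) ⊩ ψ` and `false` otherwise. -/
theorem ladheres_decidable :
    ∃ f : ℕ → Bool, Computable f ∧
      ∀ (h : ZPoHistory) (i : ℕ) (ψ : LFm), 1 ≤ i → i ≤ h.length → ψ.Closed →
        (f (Nat.pair (Encodable.encode h) (Nat.pair i ψ.enc)) = true ↔ LAdheres h i ψ) := by
  exact ⟨eMain, eMain_primrec.to_comp, fun h i ψ _ _ hψ => eMain_correct h i ψ hψ⟩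
end
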